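/- arXiv:0802.0005 — 4 statements merged into one kernel-verified Lean document; each statement's English description precedes it below -/
import Mathlib

section
/- Let n ≥ 0 and suppose U^n = G_1⋯G_r where each G_i is a conjugate of U in SL(2,ℤ). Then r ≥ n, and a finite sequence of Hurwitz moves transforms the sequence (G_1,…,G_r) into a sequence (C_1,…,C_n,D_{n+1},…,D_r) with C_1 = ⋯ = C_n = U and D_{n+1}⋯D_r = Id (the 2×2 identity matrix). -/
/-- `SL(2,ℤ)`, the group of 2×2 integer matrices of determinant 1. -/
abbrev SL2Z := Matrix.SpecialLinearGroup (Fin 2) ℤ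

/-- The matrix `U = [[1,1],[0,1]]`. -/
def U : SL2Z := ⟨!![1, 1; 0, 1], by norm_num [Matrix.det_fin_two_of]⟩

/-- The matrix `V = [[1,0],[-1,1]]`. -/
def V : SL2Z := ⟨!![1, 0; -1, 1], by norm_num [Matrix.det_fin_two_of]⟩

/-- A single Hurwitz move on a finite sequence of elements of a group: some consecutive
pair `(a, b)` is replaced by `(b, b⁻¹ * a * b)` or by `(a * b * a⁻¹, a)`. -/
def HurwitzMove {G : Type*} [Group G] (L L' : List G) : Prop :=
  ∃ (p : List G) (a b : G) (t : List G),
    L = p ++ a :: b :: t ∧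
    (L' = p ++ b :: (b⁻¹ * a * b) :: t ∨ L' = p ++ (a * b * a⁻¹) :: a :: t)

/-- A finite sequence of Hurwitz moves. -/
def HurwitzEquiv {G : Type*} [Group G] : List G → List G → Prop :=
  Relation.ReflTransGen HurwitzMove

namespace HurwitzEquiv

variable {G : Type*} [Group G] {L L' : List G}

theorem append_left (p : List G) (h : HurwitzEquiv L L') : HurwitzEquiv (p ++ L) (p ++ L') := by
  refine Relation.ReflTransGen.lift (p ++ ·) ?_ _ _ h
  rintro _ _ ⟨q, a, b, t, rfl, rfl | rfl⟩
  · exact ⟨p ++ q, a, b, t, by simp, .inl (by simp)⟩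
  · exact ⟨p ++ q, a, b, t, by simp, .inr (by simp)⟩

theorem prod_eq (h : HurwitzEquiv L L') : L'.prod = L.prod := by
  induction h with
  | refl => rfl
  | tail _ h ih =>
    rw [← ih]
    obtain ⟨q, a, b, t, rfl, rfl | rfl⟩ := h <;> simp [mul_assoc]

theorem length_eq (h : HurwitzEquiv L L') : L'.length = L.length := by
  induction h with
  | refl => rfl
  | tail _ h ih =>
    rw [← ih]
    obtain ⟨q, a, b, t, rfl, rfl | rfl⟩ := h <;> simp

theorem forall_isConj {u : G} (h : HurwitzEquiv L L') (hL : ∀ A ∈ L, IsConj u A) :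
    ∀ A ∈ L', IsConj u A := by
  induction h with
  | refl => exact hL
  | tail _ h ih =>
    obtain ⟨q, a, b, t, rfl, rfl | rfl⟩ := h
    · have h1 : IsConj u (b⁻¹ * a * b) :=
        (ih a (by simp)).trans (isConj_iff.2 ⟨b⁻¹, by simp⟩)
      grind
    · have h1 : IsConj u (a * b * a⁻¹) := (ih b (by simp)).trans (isConj_iff.2 ⟨a, rfl⟩)
      grind

theorem exists_cons_of_append (p : List G) (u : G) (t : List G) :
    ∃ t', HurwitzEquiv (p ++ u :: t) (u :: t') := by
  induction p with
  | nil => exact ⟨t, .refl⟩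
  | cons a p ih =>
    obtain ⟨t', h⟩ := ih
    exact ⟨(u⁻¹ * a * u) :: t', (h.append_left [a]).tail ⟨[], a, u, t', rfl, .inl rfl⟩⟩

theorem exists_cons_of_mem {u : G} (h : u ∈ L) : ∃ t, HurwitzEquiv L (u :: t) := by
  obtain ⟨p, t, rfl⟩ := List.append_of_mem h
  exact exists_cons_of_append p u t

end HurwitzEquiv

namespace SL2Z

/-- The matrix `[[1,0],[1,1]]`, which together with `U` generates the monoid of matrices in
`SL(2,ℤ)` with nonnegative entries. -/
def lower : SL2Z := ⟨!![1, 0; 1, 1], by norm_num [Matrix.det_fin_two_of]⟩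

/-- A matrix of order `6`, permuting `±(1,0)`, `±(0,1)`, `±(1,1)` cyclically. -/
def rot : SL2Z := ⟨!![0, 1; -1, 1], by norm_num [Matrix.det_fin_two_of]⟩

/-- The conjugate by `g` of the transvection fixing `(1,1)`. -/
def transv (g : SL2Z) : SL2Z := g * (lower * rot) * g⁻¹

/-- The product of a word in `U` (letter `true`) and `lower` (letter `false`). -/
def wordProd (F : List Bool) : SL2Z := (F.map fun b => bif b then U else lower).prod

/-- The matrices equal up to sign to a word in `U` and `lower`. -/
def posMonoid : Submonoid SL2Z := Submonoid.closure {U, lower, -1}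

@[simp] theorem wordProd_nil : wordProd [] = 1 := rfl

@[simp] theorem wordProd_true_cons (F : List Bool) : wordProd (true :: F) = U * wordProd F := by
  simp [wordProd]

@[simp] theorem wordProd_false_cons (F : List Bool) :
    wordProd (false :: F) = lower * wordProd F := by
  simp [wordProd]

@[simp] theorem wordProd_append (F K : List Bool) :
    wordProd (F ++ K) = wordProd F * wordProd K := by
  simp [wordProd]

theorem transv_neg (g : SL2Z) : transv (-g) = transv g := by
  have h : (-g)⁻¹ = -g⁻¹ := inv_eq_of_mul_eq_one_right (by simp)
  simp [transv, h]

theorem transv_mul (g h : SL2Z) : transv (g * h) = g * transv h * g⁻¹ := by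
  simp [transv, mul_assoc]

theorem transv_rot : transv rot = U := by decide

theorem rot_mul_lower : rot * lower = U := by decide

theorem rot_zpow_eq (k : ℤ) :
    ∃ s ∈ ({1, -1} : Set SL2Z), rot ^ k = s ∨ rot ^ k = s * rot ∨ rot ^ k = s * rot⁻¹ := by
  have h3 : ∀ q : ℤ, rot ^ (3 * q) = 1 ∨ rot ^ (3 * q) = -1 := by
    intro q
    rw [zpow_mul, show rot ^ (3 : ℤ) = -1 by decide]
    rcases Int.even_or_odd q with h | h
    · exact .inl h.neg_one_zpow
    · exact .inr h.neg_one_zpow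
  obtain ⟨q, h | h | h⟩ : ∃ q, k = 3 * q ∨ k = 3 * q + 1 ∨ k = 3 * q + -1 :=
    ⟨(k + 1) / 3, by omega⟩
  · exact ⟨_, h3 q, .inl (by rw [h])⟩
  · exact ⟨_, h3 q, .inr (.inl (by rw [h, zpow_add, zpow_one]))⟩
  · exact ⟨_, h3 q, .inr (.inr (by rw [h, zpow_add, zpow_neg_one]))⟩

theorem U_mem : U ∈ posMonoid := Submonoid.subset_closure (by simp)

theorem lower_mem : lower ∈ posMonoid := Submonoid.subset_closure (by simp)

theorem neg_one_mem : -1 ∈ posMonoid := Submonoid.subset_closure (by simp)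

theorem neg_mem {g : SL2Z} (h : g ∈ posMonoid) : -g ∈ posMonoid := by
  simpa using mul_mem neg_one_mem h

theorem wordProd_mem (F : List Bool) : wordProd F ∈ posMonoid := by
  induction F with
  | nil => exact one_mem _
  | cons b F ih => cases b <;> simp [mul_mem, U_mem, lower_mem, ih]

/-- All entries are nonnegative and the diagonal is positive. -/
def IsPos (g : SL2Z) : Prop := 1 ≤ g 0 0 ∧ 0 ≤ g 0 1 ∧ 0 ≤ g 1 0 ∧ 1 ≤ g 1 1

theorem IsPos.mul {g h : SL2Z} (hg : IsPos g) (hh : IsPos h) : IsPos (g * h) := by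
  obtain ⟨a, b, c, d⟩ := hg
  obtain ⟨a', b', c', d'⟩ := hh
  simp only [IsPos, Matrix.SpecialLinearGroup.coe_mul, Matrix.mul_apply, Fin.sum_univ_two]
  refine ⟨?_, ?_, ?_, ?_⟩ <;> nlinarith [mul_nonneg b c', mul_nonneg c b']

theorem isPos_U : IsPos U := by simp [IsPos, U]

theorem isPos_lower : IsPos lower := by simp [IsPos, lower]

theorem isPos_wordProd (F : List Bool) : IsPos (wordProd F) := by
  induction F with
  | nil => simp [IsPos]
  | cons b F ih =>
    cases b
    · simpa using isPos_lower.mul ih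
    · simpa using isPos_U.mul ih

theorem isPos_of_mem {g : SL2Z} (h : g ∈ posMonoid) : IsPos g ∨ IsPos (-g) := by
  induction h using Submonoid.closure_induction with
  | mem x hx =>
    rcases hx with rfl | rfl | rfl
    · exact .inl isPos_U
    · exact .inl isPos_lower
    · right; simp [IsPos]
  | one => left; simp [IsPos]
  | mul x y _ _ hx hy =>
    rcases hx with hx | hx <;> rcases hy with hy | hy
    · exact .inl (hx.mul hy)
    · right; simpa using hx.mul hy
    · right; simpa using hx.mul hy
    · left; simpa using hx.mul hy

theorem coe_U_pow (k : ℕ) :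
    ((U ^ k : SL2Z) : Matrix (Fin 2) (Fin 2) ℤ) = !![1, (k : ℤ); 0, 1] := by
  induction k with
  | zero => simp [Matrix.one_fin_two]
  | succ k ih =>
    rw [pow_succ, Matrix.SpecialLinearGroup.coe_mul, ih]
    simp [U, add_comm]

theorem coe_U : (U : Matrix (Fin 2) (Fin 2) ℤ) = !![1, 1; 0, 1] := rfl

theorem coe_rot : (rot : Matrix (Fin 2) (Fin 2) ℤ) = !![0, 1; -1, 1] := rfl

theorem coe_rot_inv : ((rot⁻¹ : SL2Z) : Matrix (Fin 2) (Fin 2) ℤ) = !![1, -1; 1, 0] := by decide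

theorem coe_lower : (lower : Matrix (Fin 2) (Fin 2) ℤ) = !![1, 0; 1, 1] := rfl

theorem exists_isPos_of_mul_eq {A B W : SL2Z} (hW : W ∈ posMonoid) {m : ℤ}
    (h : A * W = B * rot ^ m) :
    ∃ W', IsPos W' ∧ ∃ s : ℤ,
      ((A * W' : SL2Z) : Matrix (Fin 2) (Fin 2) ℤ) = s • (B : Matrix (Fin 2) (Fin 2) ℤ) ∨
      ((A * W' : SL2Z) : Matrix (Fin 2) (Fin 2) ℤ) = s • ((B * rot : SL2Z) : Matrix _ _ ℤ) ∨
      ((A * W' : SL2Z) : Matrix (Fin 2) (Fin 2) ℤ) = s • ((B * rot⁻¹ : SL2Z) : Matrix _ _ ℤ) := by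
  obtain ⟨e, he, hAW⟩ : ∃ e ∈ ({1, -1} : Set SL2Z), IsPos (e * W) := by
    rcases isPos_of_mem hW with hW | hW
    · exact ⟨1, by simp, by simpa using hW⟩
    · exact ⟨-1, by simp, by simpa using hW⟩
  refine ⟨e * W, hAW, ?_⟩
  obtain ⟨s, hs, hm⟩ := rot_zpow_eq m
  have h' : A * (e * W) = e * (B * rot ^ m) := by
    rw [← h]
    rcases he with rfl | rfl <;> simp
  rw [h']
  rcases he with rfl | rfl <;> rcases hs with rfl | rfl <;> rcases hm with hm | hm | hm <;>
    rw [hm] <;> first | (refine ⟨1, ?_⟩; simp; done) | (refine ⟨-1, ?_⟩; simp)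

theorem IsPos.mul_lower_mul_ne {A W : SL2Z} (hA : IsPos A) (hW : W ∈ posMonoid) (k : ℕ) (m : ℤ) :
    A * lower * W ≠ U ^ k * rot ^ m := by
  intro h
  obtain ⟨W', hW', s, hs⟩ := exists_isPos_of_mul_eq hW h
  obtain ⟨h1, h2, -, h4⟩ := (hA.mul isPos_lower).mul hW'
  have h3 : 1 ≤ (A * lower * W') 1 0 := by
    obtain ⟨a, b, c, d⟩ := hA
    obtain ⟨a', b', c', d'⟩ := hW'
    simp [Matrix.mul_apply, Fin.sum_univ_two, coe_lower]
    nlinarith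
  simp only [Matrix.SpecialLinearGroup.coe_mul _ rot, Matrix.SpecialLinearGroup.coe_mul _ rot⁻¹,
    coe_U_pow, coe_rot, coe_rot_inv] at hs
  rcases hs with h | h | h <;> rw [h] at h1 h2 h3 h4 <;> simp at h1 h2 h3 h4 <;> nlinarith

theorem U_mul_ne {W : SL2Z} (hW : W ∈ posMonoid) (k : ℕ) (m : ℤ) :
    U * W ≠ lower * U ^ k * rot ^ m := by
  intro h
  obtain ⟨W', hW', s, hs⟩ := exists_isPos_of_mul_eq hW h
  obtain ⟨h1, h2, h3, h4⟩ := isPos_U.mul hW'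
  have h5 : (U * W') 1 0 < (U * W') 0 0 ∧ (U * W') 1 1 ≤ (U * W') 0 1 := by
    obtain ⟨a, b, c, d⟩ := hW'
    simp [Matrix.mul_apply, Fin.sum_univ_two, coe_U]
    omega
  simp only [Matrix.SpecialLinearGroup.coe_mul _ rot, Matrix.SpecialLinearGroup.coe_mul _ rot⁻¹,
    Matrix.SpecialLinearGroup.coe_mul lower, coe_U_pow, coe_rot, coe_rot_inv, coe_lower] at hs
  rcases hs with h | h | h <;> rw [h] at h1 h2 h3 h4 h5 <;> simp at h1 h2 h3 h4 h5 <;> nlinarith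

theorem rot_mul_inv_mem (K : List Bool) :
    rot * (wordProd K)⁻¹ * rot⁻¹ * lower ∈ posMonoid := by
  induction K with
  | nil => simpa using lower_mem
  | cons b K ih =>
    cases b
    · have h : lower⁻¹ * rot⁻¹ * lower = rot⁻¹ * lower * U := by decide
      have e : rot * (wordProd (false :: K))⁻¹ * rot⁻¹ * lower =
          rot * (wordProd K)⁻¹ * rot⁻¹ * lower * U := by
        simp only [wordProd_false_cons, mul_inv_rev, mul_assoc] at h ⊢
        rw [h]
      rw [e]
      exact mul_mem ih U_mem
    · have h : U⁻¹ * rot⁻¹ * lower = rot⁻¹ * lower * lower := by decide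
      have e : rot * (wordProd (true :: K))⁻¹ * rot⁻¹ * lower =
          rot * (wordProd K)⁻¹ * rot⁻¹ * lower * lower := by
        simp only [wordProd_true_cons, mul_inv_rev, mul_assoc] at h ⊢
        rw [h]
      rw [e]
      exact mul_mem ih lower_mem

theorem exists_rot_mul_inv (F : List Bool) :
    ∃ W ∈ posMonoid, ∃ m : ℤ, rot * (wordProd F)⁻¹ = W * rot ^ m := by
  cases F with
  | nil => exact ⟨1, one_mem _, 1, by simp⟩
  | cons b F =>
    cases b
    · refine ⟨_, neg_mem (rot_mul_inv_mem F), -1, ?_⟩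
      have h : lower⁻¹ = -(rot⁻¹ * lower * rot⁻¹) := by decide
      simp only [wordProd_false_cons, mul_inv_rev, h, zpow_neg_one, mul_assoc, mul_neg, neg_mul]
    · refine ⟨_, rot_mul_inv_mem F, 1, ?_⟩
      have h : U⁻¹ = rot⁻¹ * lower * rot := by decide
      simp only [wordProd_true_cons, mul_inv_rev, h, zpow_one, mul_assoc]

/-- For two words, either the path of the second one continues that of the first in a way which
keeps the product `transv (wordProd F) * wordProd F'` reduced, or one of them extends the other
on a specified side. -/
theorem word_trichotomy (F F' : List Bool) :
    rot * (wordProd F)⁻¹ * wordProd F' * lower ∈ posMonoid ∨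
      (∃ K, F' = F ++ true :: K) ∨ ∃ K, F = F' ++ false :: K := by
  induction F generalizing F' with
  | nil =>
    rcases F' with _ | ⟨_ | _, K⟩
    · left
      simpa [rot_mul_lower] using U_mem
    · left
      simpa [← mul_assoc, rot_mul_lower] using
        mul_mem (mul_mem U_mem (wordProd_mem K)) lower_mem
    · exact .inr (.inl ⟨K, rfl⟩)
  | cons b F ih =>
    have key : ∀ b, (∃ K, F' = b :: K) →
        rot * (wordProd (b :: F))⁻¹ * wordProd F' * lower ∈ posMonoid ∨
        (∃ K, F' = b :: F ++ true :: K) ∨ ∃ K, b :: F = F' ++ false :: K := by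
      rintro b ⟨K, rfl⟩
      rcases ih K with h | ⟨K', rfl⟩ | ⟨K', rfl⟩
      · left
        cases b <;> simpa [mul_assoc] using h
      · exact .inr (.inl ⟨K', rfl⟩)
      · exact .inr (.inr ⟨K', rfl⟩)
    have hU : ∀ K ∈ posMonoid, rot * (wordProd (true :: F))⁻¹ * (lower * K) ∈ posMonoid := by
      intro K hK
      have h : U⁻¹ * lower = rot⁻¹ * lower * U := by decide
      have e : rot * (wordProd (true :: F))⁻¹ * (lower * K) =
          rot * (wordProd F)⁻¹ * rot⁻¹ * lower * (U * K) := by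
        simp only [wordProd_true_cons, mul_inv_rev, mul_assoc]
        rw [← mul_assoc U⁻¹, h]
        simp only [mul_assoc]
      rw [e]
      exact mul_mem (rot_mul_inv_mem F) (mul_mem U_mem hK)
    rcases b with _ | _ <;> rcases F' with _ | ⟨_ | _, K⟩
    · exact .inr (.inr ⟨F, rfl⟩)
    · exact key _ ⟨K, rfl⟩
    · left
      have h : lower⁻¹ * U = rot⁻¹ * lower * -lower := by decide
      have e : rot * (wordProd (false :: F))⁻¹ * wordProd (true :: K) * lower =
          rot * (wordProd F)⁻¹ * rot⁻¹ * lower * (-lower * (wordProd K * lower)) := by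
        simp only [wordProd_true_cons, wordProd_false_cons, mul_inv_rev, mul_assoc]
        rw [← mul_assoc lower⁻¹, h]
        simp only [mul_assoc]
      rw [e]
      exact mul_mem (rot_mul_inv_mem F)
        (mul_mem (neg_mem lower_mem) (mul_mem (wordProd_mem K) lower_mem))
    · left
      simpa using hU 1 (one_mem _)
    · left
      simpa [mul_assoc] using hU _ (mul_mem (wordProd_mem K) lower_mem)
    · exact key _ ⟨K, rfl⟩

/-- A normalized expression `rot ^ shift * word` for an edge of the Farey tree; it describes the
conjugate `transv (rot ^ shift * word)` of `U`. -/
structure FareyPath where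
  shift : ℤ
  word : List Bool
  head_ne : word.head? ≠ some true

namespace FareyPath

/-- The matrix described by a path. -/
def toSL (c : FareyPath) : SL2Z := rot ^ c.shift * wordProd c.word

theorem exists_toSL_eq (i : ℤ) (K : List Bool) :
    ∃ c : FareyPath, c.word.length ≤ K.length ∧ c.toSL = rot ^ i * wordProd K := by
  rcases K with _ | ⟨_ | _, K⟩
  · exact ⟨⟨i, [], by simp⟩, le_rfl, rfl⟩
  · exact ⟨⟨i, false :: K, by simp⟩, le_rfl, rfl⟩
  · refine ⟨⟨i + 1, false :: K, by simp⟩, le_rfl, ?_⟩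
    simp [toSL, zpow_add, ← rot_mul_lower, mul_assoc]

theorem exists_transv_eq (i : ℤ) (F K : List Bool) (r : SL2Z) (hr : r = rot ∨ r = rot⁻¹) :
    ∃ c : FareyPath, c.word.length ≤ F.length + K.length ∧
      transv c.toSL = transv (rot ^ i * wordProd F * r * wordProd K) := by
  induction F using List.reverseRecOn generalizing K r with
  | nil =>
    rcases hr with rfl | rfl
    · obtain ⟨c, hc, h⟩ := exists_toSL_eq (i + 1) K
      exact ⟨c, by simpa using hc, by rw [h]; simp [zpow_add]⟩
    · obtain ⟨c, hc, h⟩ := exists_toSL_eq (i + -1) K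
      exact ⟨c, by simpa using hc, by rw [h]; simp [zpow_add]⟩
  | append_singleton F b ih =>
    have cancel : ∀ r', (r' = rot ∨ r' = rot⁻¹) → ∀ K', K'.length ≤ K.length →
        (∀ g, transv (g * (wordProd [b] * r * wordProd K)) = transv (g * (r' * wordProd K'))) →
        ∃ c : FareyPath, c.word.length ≤ (F ++ [b]).length + K.length ∧
          transv c.toSL = transv (rot ^ i * wordProd (F ++ [b]) * r * wordProd K) := by
      intro r' hr' K' hK' ht
      obtain ⟨c, hc, h⟩ := ih K' r' hr'
      refine ⟨c, by simp; omega, ?_⟩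
      have := ht (rot ^ i * wordProd F)
      simp only [wordProd_append, mul_assoc] at this h ⊢
      rw [h, this]
    have word : ∀ K', K'.length ≤ K.length + 1 →
        (∀ g, transv (g * (wordProd [b] * r * wordProd K)) = transv (g * wordProd K')) →
        ∃ c : FareyPath, c.word.length ≤ (F ++ [b]).length + K.length ∧
          transv c.toSL = transv (rot ^ i * wordProd (F ++ [b]) * r * wordProd K) := by
      intro K' hK' ht
      obtain ⟨c, hc, h⟩ := exists_toSL_eq i (F ++ K')
      refine ⟨c, by simp at hc ⊢; omega, ?_⟩
      have := ht (rot ^ i * wordProd F)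
      simp only [wordProd_append, mul_assoc] at this h ⊢
      rw [h, this]
    have pos : ∀ {x y : SL2Z}, x = y → ∀ g W : SL2Z, transv (g * (x * W)) = transv (g * (y * W)) :=
      fun h _ _ => by rw [h]
    have neg : ∀ {x y : SL2Z}, x = -y → ∀ g W : SL2Z, transv (g * (x * W)) = transv (g * (y * W)) :=
      fun h _ _ => by rw [h, neg_mul, mul_neg, transv_neg]
    have stab : ∀ {x y : SL2Z}, transv x = transv y → ∀ g : SL2Z,
        transv (g * (x * wordProd [])) = transv (g * (y * wordProd [])) :=
      fun h _ => by simp only [wordProd_nil, mul_one, transv_mul _ _, h]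
    rcases hr with rfl | rfl <;> rcases K with _ | ⟨_ | _, K⟩ <;> rcases b with _ | _
    · exact word [] (by simp) (by simpa using stab (x := lower * rot) (y := 1) (by decide))
    · exact cancel rot (.inl rfl) [] (by simp)
        (by simpa using stab (x := U * rot) (y := rot) (by decide))
    · exact word (false :: true :: K) (by simp)
        (by simpa [mul_assoc] using fun g =>
          pos (x := lower * rot * lower) (y := lower * U) (by decide) g (wordProd K))
    · exact word (true :: true :: K) (by simp)
        (by simpa [mul_assoc] using fun g =>
          pos (x := U * rot * lower) (y := U * U) (by decide) g (wordProd K))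
    · exact cancel rot (.inl rfl) K (by simp)
        (by simpa [mul_assoc] using fun g =>
          pos (x := lower * rot * U) (y := rot) (by decide) g (wordProd K))
    · exact cancel rot⁻¹ (.inr rfl) K (by simp)
        (by simpa [mul_assoc] using fun g =>
          neg (x := U * rot * U) (y := rot⁻¹) (by decide) g (wordProd K))
    · exact cancel rot⁻¹ (.inr rfl) [] (by simp)
        (by simpa using stab (x := lower * rot⁻¹) (y := rot⁻¹) (by decide))
    · exact word [] (by simp) (by simpa using stab (x := U * rot⁻¹) (y := 1) (by decide))
    · exact cancel rot (.inl rfl) K (by simp)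
        (by simpa [mul_assoc] using fun g =>
          neg (x := lower * rot⁻¹ * lower) (y := rot) (by decide) g (wordProd K))
    · exact cancel rot⁻¹ (.inr rfl) K (by simp)
        (by simpa [mul_assoc] using fun g =>
          pos (x := U * rot⁻¹ * lower) (y := rot⁻¹) (by decide) g (wordProd K))
    · exact word (false :: false :: K) (by simp)
        (by simpa [mul_assoc] using fun g =>
          pos (x := lower * rot⁻¹ * U) (y := lower * lower) (by decide) g (wordProd K))
    · exact word (true :: false :: K) (by simp)
        (by simpa [mul_assoc] using fun g =>
          pos (x := U * rot⁻¹ * U) (y := U * lower) (by decide) g (wordProd K))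

theorem exists_transv_eq_of_isConj {A : SL2Z} (h : IsConj U A) :
    ∃ c : FareyPath, transv c.toSL = A := by
  have hrot : ∀ (i : ℤ) (c : FareyPath),
      ∃ c' : FareyPath, transv c'.toSL = transv (rot ^ i * c.toSL) :=
    fun i c => ⟨⟨i + c.shift, c.word, c.head_ne⟩, by simp [toSL, zpow_add, mul_assoc]⟩
  have hword : ∀ b (c : FareyPath),
      ∃ c' : FareyPath, transv c'.toSL = transv (wordProd [b] * c.toSL) := by
    intro b c
    obtain ⟨s, hs, hk⟩ := rot_zpow_eq c.shift
    have ht : ∀ g h : SL2Z, transv (g * (s * h)) = transv (g * h) := by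
      rcases hs with rfl | rfl <;> simp [transv_neg]
    rcases hk with hk | hk | hk
    · obtain ⟨c', -, h⟩ := exists_toSL_eq 0 (b :: c.word)
      exact ⟨c', by rw [h, toSL, hk, ht, ← wordProd_append]; simp⟩
    · obtain ⟨c', -, h⟩ := exists_transv_eq 0 [b] c.word rot (.inl rfl)
      exact ⟨c', by rw [h, toSL, hk, mul_assoc s, ht]; simp [mul_assoc]⟩
    · obtain ⟨c', -, h⟩ := exists_transv_eq 0 [b] c.word rot⁻¹ (.inr rfl)
      exact ⟨c', by rw [h, toSL, hk, mul_assoc s, ht]; simp [mul_assoc]⟩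
  let M : Submonoid SL2Z :=
    { carrier := {g | ∀ c : FareyPath, ∃ c' : FareyPath, transv c'.toSL = transv (g * c.toSL)}
      one_mem' := fun c => ⟨c, by simp⟩
      mul_mem' := by
        intro g g' hg hg' c
        obtain ⟨c₁, h₁⟩ := hg' c
        obtain ⟨c₂, h₂⟩ := hg c₁
        exact ⟨c₂, by rw [h₂, transv_mul, h₁, ← transv_mul, mul_assoc]⟩ }
  have rot_mem : ∀ i : ℤ, rot ^ i ∈ M := hrot
  have word_mem : ∀ b, wordProd [b] ∈ M := hword
  have hU : U ∈ M := by simpa using word_mem true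
  have hU' : U⁻¹ ∈ M := by
    rw [show U⁻¹ = rot ^ (-1 : ℤ) * wordProd [false] * rot ^ (1 : ℤ) by decide]
    exact mul_mem (mul_mem (rot_mem _) (word_mem _)) (rot_mem _)
  have hM : ∀ g, g ∈ M := by
    intro g
    have hg : g ∈ Subgroup.closure {ModularGroup.S, ModularGroup.T} := by
      rw [SpecialLinearGroup.SL2Z_generators]; trivial
    induction hg using Subgroup.closure_induction'' with
    | mem x hx =>
      rcases hx with rfl | rfl
      · rw [show ModularGroup.S = U⁻¹ * rot ^ (-1 : ℤ) by decide]
        exact mul_mem hU' (rot_mem _)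
      · exact hU
    | inv_mem x hx =>
      rcases hx with rfl | rfl
      · rw [show ModularGroup.S⁻¹ = rot ^ (1 : ℤ) * U by decide]
        exact mul_mem (rot_mem _) hU
      · exact hU'
    | one => exact one_mem _
    | mul x y _ _ hx hy => exact mul_mem hx hy
  obtain ⟨g, rfl⟩ := isConj_iff.1 h
  obtain ⟨c, hc⟩ := hM g ⟨1, [], by simp⟩
  refine ⟨c, ?_⟩
  rw [hc, transv_mul, show toSL ⟨1, [], by simp⟩ = rot by simp [toSL], transv_rot]

theorem exists_transv_eq_conj {c d : FareyPath} {K : List Bool}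
    (hd : transv d.toSL = transv (c.toSL * (U * wordProd K)))
    (hK : c.word.length + K.length < d.word.length) :
    ∃ d' : FareyPath, d'.word.length < d.word.length ∧
      transv d'.toSL = transv c.toSL * transv d.toSL * (transv c.toSL)⁻¹ := by
  obtain ⟨d', h, h'⟩ := exists_transv_eq c.shift c.word K rot (.inl rfl)
  refine ⟨d', h.trans_lt hK, ?_⟩
  have e : lower * rot * U = rot := by decide
  rw [h', hd, ← transv_mul]
  congr 1
  rw [transv, ← toSL, mul_assoc _ c.toSL⁻¹, inv_mul_cancel_left, mul_assoc c.toSL,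
    mul_assoc c.toSL, ← mul_assoc _ U, e]

theorem exists_transv_eq_inv_conj {c d : FareyPath} {K : List Bool}
    (hc : transv c.toSL = transv (d.toSL * (lower * wordProd K)))
    (hK : d.word.length + K.length < c.word.length) :
    ∃ c' : FareyPath, c'.word.length < c.word.length ∧
      transv c'.toSL = (transv d.toSL)⁻¹ * transv c.toSL * transv d.toSL := by
  obtain ⟨c', h, h'⟩ := exists_transv_eq d.shift d.word K rot⁻¹ (.inr rfl)
  refine ⟨c', h.trans_lt hK, ?_⟩
  have e : (lower * rot)⁻¹ * lower = rot⁻¹ := by decide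
  have e' : (transv d.toSL)⁻¹ = d.toSL * (lower * rot)⁻¹ * d.toSL⁻¹ := by
    simp [transv, mul_assoc]
  have e'' : ∀ g : SL2Z, (transv d.toSL)⁻¹ * transv g * transv d.toSL =
      transv ((transv d.toSL)⁻¹ * g) := by simp [transv_mul]
  rw [h', hc, e'']
  congr 1
  rw [e', ← toSL, mul_assoc _ d.toSL⁻¹, inv_mul_cancel_left, mul_assoc d.toSL,
    mul_assoc d.toSL, ← mul_assoc _ lower, e]

/-- The first conjugate of `U` followed by the second one maps a positive cone to a positive cone:
no cancellation takes place between the two paths. -/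
def Reduced (c d : FareyPath) : Prop := rot * c.toSL⁻¹ * d.toSL * lower ∈ posMonoid

theorem reduced_or (c d : FareyPath) :
    Reduced c d ∨
    (∃ d' : FareyPath, d'.word.length < d.word.length ∧
      transv d'.toSL = transv c.toSL * transv d.toSL * (transv c.toSL)⁻¹) ∨
    (∃ c' : FareyPath, c'.word.length < c.word.length ∧
      transv c'.toSL = (transv d.toSL)⁻¹ * transv c.toSL * transv d.toSL) ∨
    transv c.toSL = U ∨ transv d.toSL = U ∨
      (transv d.toSL)⁻¹ * transv c.toSL * transv d.toSL = U := by
  obtain ⟨i, F, hF⟩ := c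
  obtain ⟨j, F', hF'⟩ := d
  obtain ⟨k, rfl⟩ : ∃ k, j = i + k := ⟨j - i, by ring⟩
  obtain ⟨s, hs, hk⟩ := rot_zpow_eq k
  have ht : ∀ g h : SL2Z, transv (g * (s * h)) = transv (g * h) := by
    rcases hs with rfl | rfl <;> simp [transv_neg]
  have hsm : ∀ g h : SL2Z, g * h ∈ posMonoid → g * (s * h) ∈ posMonoid := by
    rcases hs with rfl | rfl
    · simp
    · intro g h hh
      simpa using neg_mem hh
  rcases hk with hk | hk | hk
  · rcases word_trichotomy F F' with h | ⟨K, rfl⟩ | ⟨K, rfl⟩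
    · left
      simp only [Reduced, toSL, zpow_add, hk]
      simpa [mul_assoc] using hsm (rot * (wordProd F)⁻¹) (wordProd F' * lower)
        (by simpa [mul_assoc] using h)
    · refine .inr (.inl (exists_transv_eq_conj (K := K) ?_ (by simp)))
      simp [toSL, zpow_add, hk, mul_assoc, ht]
    · refine .inr (.inr (.inl (exists_transv_eq_inv_conj (K := K) ?_ (by simp))))
      simp only [toSL, zpow_add, hk, mul_assoc, wordProd_append, ht]
      simp
  · rcases F with _ | ⟨_ | _, K⟩
    · rcases F' with _ | ⟨_ | _, K⟩
      · simp only [toSL, zpow_add, hk, wordProd_nil, mul_one, ht]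
        obtain ⟨s', hs', hi⟩ := rot_zpow_eq i
        refine .inr (.inr (.inr ?_))
        rcases hs' with rfl | rfl <;> rcases hi with hi | hi | hi <;> rw [hi] <;> decide
      · refine .inr (.inl (exists_transv_eq_conj (K := K) ?_ (by simp)))
        simp only [toSL, zpow_add, hk, mul_assoc, ht]
        simp [← mul_assoc, ← rot_mul_lower]
      · simp at hF'
    · left
      simp only [Reduced, toSL, zpow_add, hk]
      suffices rot * (wordProd (false :: K))⁻¹ * (rot * wordProd F' * lower) ∈ posMonoid by
        simpa [mul_assoc] using hsm (rot * (wordProd (false :: K))⁻¹) _ this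
      have h := rot_mul_inv_mem K
      have e : lower⁻¹ * U = -(rot⁻¹ * lower * lower) := by decide
      have hU : ∀ g ∈ posMonoid, rot * (wordProd (false :: K))⁻¹ * (U * g) ∈ posMonoid := by
        intro g hg
        have e' : rot * (wordProd (false :: K))⁻¹ * (U * g) =
            (rot * (wordProd K)⁻¹ * rot⁻¹ * lower) * (-(lower * g)) := by
          simp only [wordProd_false_cons, mul_inv_rev, mul_assoc]
          rw [← mul_assoc lower⁻¹, e]
          simp [mul_assoc]
        rw [e']
        exact mul_mem h (neg_mem (mul_mem lower_mem hg))
      rcases F' with _ | ⟨_ | _, K'⟩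
      · simpa [rot_mul_lower] using hU 1 (one_mem _)
      · have e'' : rot * wordProd (false :: K') * lower = U * (wordProd K' * lower) := by
          simp [← rot_mul_lower, mul_assoc]
        rw [e'']
        exact hU _ (mul_mem (wordProd_mem K') lower_mem)
      · simp at hF'
    · simp at hF
  · left
    simp only [Reduced, toSL, zpow_add, hk]
    suffices rot * (wordProd F)⁻¹ * (rot⁻¹ * wordProd F' * lower) ∈ posMonoid by
      simpa [mul_assoc] using hsm (rot * (wordProd F)⁻¹) _ this
    have h := rot_mul_inv_mem F
    rcases F' with _ | ⟨_ | _, K⟩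
    · simpa [mul_assoc] using h
    · simpa [mul_assoc] using mul_mem h (mul_mem (wordProd_mem K) lower_mem)
    · simp at hF'

/-- Hurwitz moves shortening the paths lead to a reduced sequence, unless `U` shows up first. -/
theorem exists_isChain_or_mem (cs : List FareyPath) :
    (∃ cs' : List FareyPath, HurwitzEquiv (cs.map fun c => transv c.toSL)
      (cs'.map fun c => transv c.toSL) ∧ cs'.IsChain Reduced) ∨
    ∃ L, HurwitzEquiv (cs.map fun c => transv c.toSL) L ∧ U ∈ L := by
  induction hN : (cs.map fun c => c.word.length).sum using Nat.strong_induction_on generalizing cs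
    with | _ N ih
  by_cases hcs : cs.IsChain Reduced
  · exact .inl ⟨cs, .refl, hcs⟩
  obtain ⟨c, d, p, t, rfl, hcd⟩ : ∃ c d p t, cs = p ++ c :: d :: t ∧ ¬ Reduced c d := by
    simpa [List.isChain_iff_forall_rel_of_append_cons_cons] using hcs
  have step : (∃ cs₁ : List FareyPath, (cs₁.map fun c => c.word.length).sum < N ∧
      HurwitzMove ((p ++ c :: d :: t).map fun c => transv c.toSL)
        (cs₁.map fun c => transv c.toSL)) ∨
      ∃ L, HurwitzEquiv ((p ++ c :: d :: t).map fun c => transv c.toSL) L ∧ U ∈ L := by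
    simp only [List.map_append, List.map_cons, List.sum_append, List.sum_cons] at hN ⊢
    rcases reduced_or c d with h | ⟨d', hlt, h⟩ | ⟨c', hlt, h⟩ | h | h | h
    · exact absurd h hcd
    · exact .inl ⟨p ++ d' :: c :: t, by simp; omega, _, _, _, _, rfl, .inr (by simp [h])⟩
    · exact .inl ⟨p ++ d :: c' :: t, by simp; omega, _, _, _, _, rfl, .inl (by simp [h])⟩
    · exact .inr ⟨_, .refl, by simp [h]⟩
    · exact .inr ⟨_, .refl, by simp [h]⟩
    · exact .inr ⟨_, .single ⟨_, _, _, _, rfl, .inl rfl⟩, by simp [h]⟩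
  rcases step with ⟨cs₁, hlt, hmove⟩ | h
  · exact (ih _ hlt cs₁ rfl).imp
      (fun ⟨cs', h, h'⟩ => ⟨cs', h.head hmove, h'⟩) (fun ⟨L, h, h'⟩ => ⟨L, h.head hmove, h'⟩)
  · exact .inr h

theorem exists_prod_eq (c : FareyPath) (t : List FareyPath) (h : (c :: t).IsChain Reduced) :
    ∃ W ∈ posMonoid, ∃ m : ℤ,
      ((c :: t).map fun c => transv c.toSL).prod = c.toSL * lower * W * rot ^ m := by
  induction t generalizing c with
  | nil =>
    obtain ⟨W, hW, m, h⟩ := exists_rot_mul_inv c.word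
    refine ⟨W, hW, m - c.shift, ?_⟩
    simp only [List.map_cons, List.map_nil, List.prod_singleton, transv, sub_eq_add_neg, zpow_add,
      mul_assoc, ← mul_assoc W, ← h]
    simp [toSL, mul_assoc]
  | cons d t ih =>
    rw [List.isChain_cons_cons] at h
    obtain ⟨W, hW, m, hm⟩ := ih d h.2
    refine ⟨_, mul_mem h.1 hW, m, ?_⟩
    rw [List.map_cons, List.prod_cons, hm]
    simp [transv, mul_assoc]

theorem transv_eq_of_mul_eq {c : FareyPath} {W : SL2Z} (hW : W ∈ posMonoid) {m : ℤ} {n : ℕ}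
    (h : c.toSL * lower * W * rot ^ m = U ^ (n + 1)) : transv c.toSL = U := by
  obtain ⟨i, F, hF⟩ := c
  obtain ⟨s, hs, hi⟩ := rot_zpow_eq (-i)
  have hP : wordProd F * lower * W = rot ^ (-i) * U ^ (n + 1) * rot ^ (-m) := by
    rw [← h]
    simp [toSL, mul_assoc]
  obtain ⟨k, hk⟩ : ∃ k : ℤ, ∀ x : SL2Z, s * x * rot ^ (-m) = x * rot ^ k := by
    rcases hs with rfl | rfl
    · exact ⟨-m, by simp⟩
    · exact ⟨3 + -m, by simp [zpow_add, show rot ^ (3 : ℤ) = -1 by decide]⟩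
  rcases hi with hi | hi | hi <;> rw [hi] at hP
  · exact absurd (hP.trans (hk _)) ((isPos_wordProd F).mul_lower_mul_ne hW _ _)
  · exfalso
    have e : rot * rot * U = lower * rot ^ (3 : ℤ) := by decide
    obtain ⟨W', hW', hF⟩ : ∃ W' ∈ posMonoid, wordProd F * lower * W = lower * W' := by
      rcases F with _ | ⟨_ | _, K⟩
      · exact ⟨W, hW, by simp⟩
      · exact ⟨wordProd K * lower * W, mul_mem (mul_mem (wordProd_mem K) lower_mem) hW,
          by simp [mul_assoc]⟩
      · simp at hF
    refine U_mul_ne hW' n (3 + k) ?_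
    have e' : rot ^ (3 : ℤ) = -1 := by decide
    rw [show U * W' = rot * lower * W' by rw [rot_mul_lower], mul_assoc, ← hF, hP, mul_assoc s, hk,
      pow_succ']
    simp only [← mul_assoc, e, zpow_add, e']
    simp
  · rw [mul_assoc s, hk, pow_succ', ← mul_assoc rot⁻¹, show rot⁻¹ * U = lower by decide] at hP
    rcases F with _ | ⟨_ | _, K⟩
    · have : rot ^ i = (s * rot⁻¹)⁻¹ := by rw [← hi, zpow_neg, inv_inv]
      simp only [toSL, this, wordProd_nil, mul_one]
      rcases hs with rfl | rfl <;> decide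
    · refine absurd ?_ ((isPos_wordProd K).mul_lower_mul_ne hW n k)
      simpa [mul_assoc] using hP
    · simp at hF

end FareyPath

theorem exists_hurwitzEquiv_cons {L : List SL2Z} (hL : ∀ A ∈ L, IsConj U A) {n : ℕ}
    (h : L.prod = U ^ (n + 1)) : ∃ t, HurwitzEquiv L (U :: t) := by
  obtain ⟨cs, rfl⟩ : ∃ cs : List FareyPath, (cs.map fun c => transv c.toSL) = L := by
    have : L ∈ Set.range (List.map fun c : FareyPath => transv c.toSL) := by
      rw [Set.range_list_map]
      exact fun A hA => FareyPath.exists_transv_eq_of_isConj (hL A hA)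
    exact this
  rcases FareyPath.exists_isChain_or_mem cs with ⟨cs', hcs, hch⟩ | ⟨L', hL', hU⟩
  · rcases cs' with _ | ⟨c, t⟩
    · have e := hcs.prod_eq
      rw [h] at e
      have := congr_arg (fun g : SL2Z => (g : Matrix (Fin 2) (Fin 2) ℤ) 0 1) e
      rw [coe_U_pow] at this
      simp at this
      omega
    · obtain ⟨W, hW, m, hm⟩ := FareyPath.exists_prod_eq c t hch
      rw [hcs.prod_eq, h] at hm
      have hc := FareyPath.transv_eq_of_mul_eq hW hm.symm
      exact ⟨_, by simpa [hc] using hcs⟩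
  · obtain ⟨t, ht⟩ := HurwitzEquiv.exists_cons_of_mem hU
    exact ⟨t, hL'.trans ht⟩

end SL2Z

/-- **Normal factorization for Kodaira type `wIₙ`** : if `Uⁿ = G₁⋯Gᵣ` with each `Gᵢ` a
conjugate of `U` in `SL(2,ℤ)`, then `r ≥ n` and a finite sequence of Hurwitz moves transforms
`(G₁,…,Gᵣ)` into `(U,…,U,Dₙ₊₁,…,Dᵣ)` (with `n` copies of `U`) where `Dₙ₊₁⋯Dᵣ = 1`. -/
theorem normal_factorization_wIn (n : ℕ) (L : List SL2Z)
    (hconj : ∀ A ∈ L, IsConj U A)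
    (hprod : L.prod = U ^ n) :
    n ≤ L.length ∧
    ∃ D : List SL2Z,
      HurwitzEquiv L (List.replicate n U ++ D) ∧ D.prod = 1 := by
  suffices ∃ D : List SL2Z, HurwitzEquiv L (List.replicate n U ++ D) ∧ D.prod = 1 by
    obtain ⟨D, hD, hD'⟩ := this
    refine ⟨?_, D, hD, hD'⟩
    rw [← hD.length_eq]
    simp
  induction n generalizing L with
  | zero => exact ⟨L, .refl, by simpa using hprod⟩
  | succ n ih =>
    obtain ⟨t, ht⟩ := SL2Z.exists_hurwitzEquiv_cons hconj hprod
    have hp := ht.prod_eq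
    rw [hprod, List.prod_cons, pow_succ'] at hp
    obtain ⟨D, hD, hD'⟩ := ih t
      (fun A hA => ht.forall_isConj hconj A (List.mem_cons_of_mem _ hA)) (mul_left_cancel hp)
    exact ⟨D, ht.trans (hD.append_left [U]), hD'⟩
end

section
/- Suppose VU = G_1⋯G_r where each G_i is a conjugate of U in SL(2,ℤ). Then r ≥ 2, and a finite sequence of Hurwitz moves transforms the sequence (G_1,…,G_r) into a sequence (V, U, D_3,…,D_r) with D_3⋯D_r = Id (the 2×2 identity matrix). -/
namespace NormalFactorization

/-- The element of order `4` exchanging the two sides of the edge `{0, ∞}` of the Farey graph. -/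
def J : SL2Z := ⟨!![0, -1; 1, 0], by norm_num [Matrix.det_fin_two_of]⟩

/-- The powers of the element `-VU` of order `3`. -/
def rot : Fin 3 → SL2Z
  | 0 => 1
  | 1 => ⟨!![-1, -1; 1, 0], by norm_num [Matrix.det_fin_two_of]⟩
  | 2 => ⟨!![0, 1; -1, -1], by norm_num [Matrix.det_fin_two_of]⟩

/-- The two steps of the Stern–Brocot tree, up to sign. -/
def step : Bool → SL2Z
  | true => J * rot 1
  | false => J * rot 2

/-- The matrix reached by a path in the Stern–Brocot tree. -/
def walk (w : List Bool) : SL2Z := (w.map step).prod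

/-- Codes for the conjugates of `U`, according to the position of the fixed slope with respect
to the triangle `{0, -1, ∞}` of the Farey graph. -/
inductive Code
  | corner (k : Fin 3)
  | inner (i : Fin 3) (w : List Bool)

namespace Code

/-- The conjugate of `U` described by a code. -/
def val : Code → SL2Z
  | corner k => rot k * U * (rot k)⁻¹
  | inner i w => (rot i * walk w * J * rot 1) * U * (rot i * walk w * J * rot 1)⁻¹

/-- The distance from the base triangle to the fixed slope. -/
def depth : Code → ℕ
  | corner _ => 0
  | inner _ w => w.length + 1

/-- The half-plane attracting the base triangle. -/
def plus : Code → SL2Z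
  | corner k => rot k
  | inner i w => rot i * walk (w ++ [true])

/-- The half-plane attracting the base triangle under the inverse. -/
def minus : Code → SL2Z
  | corner k => rot (k + 1)
  | inner i w => rot i * walk (w ++ [false])

end Code

open Code

@[simp] lemma walk_nil : walk [] = 1 := rfl

@[simp] lemma walk_cons (b : Bool) (w : List Bool) : walk (b :: w) = step b * walk w := by
  simp [walk]

@[simp] lemma walk_append (u w : List Bool) : walk (u ++ w) = walk u * walk w := by
  simp [walk]

lemma J_mul_J : J * J = -1 := by decide

lemma J_inv : J⁻¹ = -J := by decide

@[simp] lemma rot_zero : rot 0 = 1 := rfl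

lemma rot_mul : ∀ i j, rot i * rot j = rot (i + j) := by decide

lemma conj_neg (x y : SL2Z) : (-x) * y * (-x)⁻¹ = x * y * x⁻¹ := by
  simp [inv_neg]

lemma J_mul_inv (g : SL2Z) : J * g⁻¹ = g.transpose * J := by
  apply Subtype.ext
  rw [Matrix.SpecialLinearGroup.coe_mul, Matrix.SpecialLinearGroup.coe_mul,
    Matrix.SpecialLinearGroup.coe_inv, Matrix.SpecialLinearGroup.coe_transpose,
    Matrix.adjugate_fin_two]
  ext i j
  fin_cases i <;> fin_cases j <;> simp [J, Matrix.mul_apply, Fin.sum_univ_two]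

/-- All entries have the same weak sign. -/
def SameSign (X : SL2Z) : Prop := (∀ i j, 0 ≤ X.1 i j) ∨ (∀ i j, X.1 i j ≤ 0)

instance : DecidablePred SameSign := fun _ =>
  @instDecidableOr _ _
    (@Nat.decidableForallFin 2 _ fun _ => @Nat.decidableForallFin 2 _ fun _ => Int.decLe _ _)
    (@Nat.decidableForallFin 2 _ fun _ => @Nat.decidableForallFin 2 _ fun _ => Int.decLe _ _)

lemma SameSign.mul {X Y : SL2Z} (hX : SameSign X) (hY : SameSign Y) : SameSign (X * Y) := by
  unfold SameSign
  simp only [Matrix.SpecialLinearGroup.coe_mul, Matrix.mul_apply, Fin.sum_univ_two]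
  rcases hX with hX | hX <;> rcases hY with hY | hY
  · exact Or.inl fun i j => add_nonneg (mul_nonneg (hX _ _) (hY _ _)) (mul_nonneg (hX _ _) (hY _ _))
  · exact Or.inr fun i j => add_nonpos (mul_nonpos_of_nonneg_of_nonpos (hX _ _) (hY _ _))
      (mul_nonpos_of_nonneg_of_nonpos (hX _ _) (hY _ _))
  · exact Or.inr fun i j => add_nonpos (mul_nonpos_of_nonpos_of_nonneg (hX _ _) (hY _ _))
      (mul_nonpos_of_nonpos_of_nonneg (hX _ _) (hY _ _))
  · exact Or.inl fun i j => add_nonneg (mul_nonneg_of_nonpos_of_nonpos (hX _ _) (hY _ _))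
      (mul_nonneg_of_nonpos_of_nonpos (hX _ _) (hY _ _))

lemma SameSign.transpose {X : SL2Z} (hX : SameSign X) : SameSign X.transpose := by
  rcases hX with hX | hX
  · exact Or.inl fun i j => hX j i
  · exact Or.inr fun i j => hX j i

lemma sameSign_step : ∀ b, SameSign (step b) := by decide

lemma sameSign_walk (w : List Bool) : SameSign (walk w) := by
  induction w with
  | nil => decide
  | cons b w ih => simpa using (sameSign_step b).mul ih

/-- Half-planes in different sectors of the base triangle are disjoint. -/
lemma sameSign_of_ne {i j : Fin 3} (hij : i ≠ j) (u w : List Bool) :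
    SameSign (J * (rot i * walk u)⁻¹ * (rot j * walk w)) := by
  have h : J * (rot i * walk u)⁻¹ * (rot j * walk w)
      = (walk u).transpose * (J * (rot i)⁻¹ * rot j) * walk w := by
    rw [mul_inv_rev, ← mul_assoc J, J_mul_inv]
    group
  have h0 : ∀ i j : Fin 3, i ≠ j → SameSign (J * (rot i)⁻¹ * rot j) := by decide
  rw [h]
  exact ((sameSign_walk u).transpose.mul (h0 i j hij)).mul (sameSign_walk w)

/-- Half-planes reached by diverging paths are disjoint. -/
lemma sameSign_of_diverge (i : Fin 3) (p : List Bool) (b : Bool) (s t : List Bool) :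
    SameSign (J * (rot i * walk (p ++ b :: s))⁻¹ * (rot i * walk (p ++ (!b) :: t))) := by
  have h : J * (rot i * walk (p ++ b :: s))⁻¹ * (rot i * walk (p ++ (!b) :: t))
      = (walk s).transpose * (J * (step b)⁻¹ * step (!b)) * walk t := by
    have : (rot i * walk (p ++ b :: s))⁻¹ * (rot i * walk (p ++ (!b) :: t))
        = (walk s)⁻¹ * ((step b)⁻¹ * step (!b) * walk t) := by
      simp only [walk_append, walk_cons]
      group
    rw [mul_assoc, this, ← mul_assoc, J_mul_inv]
    group
  have h0 : ∀ b, SameSign (J * (step b)⁻¹ * step (!b)) := by decide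
  rw [h]
  exact ((sameSign_walk s).transpose.mul (h0 b)).mul (sameSign_walk t)

lemma val_eq (f : Code) : f.val = f.plus * J * f.minus⁻¹ := by
  cases f with
  | corner k =>
    revert k
    decide
  | inner i w =>
    have h : (J * rot 1) * U * (J * rot 1)⁻¹ = step true * J * (step false)⁻¹ := by decide
    calc _ = (rot i * walk w) * ((J * rot 1) * U * (J * rot 1)⁻¹) * (rot i * walk w)⁻¹ := by
          simp only [val]; group
      _ = _ := by rw [h]; simp only [plus, minus, walk_append, walk_cons, walk_nil]; group

lemma conj_conj (a x y : SL2Z) : a * (x * y * x⁻¹) * a⁻¹ = a * x * y * (a * x)⁻¹ := by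
  group

lemma exists_conj_rot (i : Fin 3) (f : Code) :
    ∃ f' : Code, f'.val = rot i * f.val * (rot i)⁻¹ ∧ f'.depth = f.depth := by
  cases f with
  | corner k => exact ⟨corner (i + k), by rw [val, val, conj_conj, rot_mul], rfl⟩
  | inner j w =>
    refine ⟨inner (i + j) w, ?_, rfl⟩
    rw [val, val, conj_conj, ← rot_mul]
    simp only [mul_assoc]

lemma exists_conj_J_inner_zero (w : List Bool) :
    ∃ f' : Code, f'.val = J * (inner 0 w).val * J⁻¹ ∧ f'.depth = w.length := by
  rcases w with _ | ⟨b | b, w⟩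
  · exact ⟨corner 1, by decide, rfl⟩
  · refine ⟨inner 2 w, ?_, rfl⟩
    rw [val, val, conj_conj, ← conj_neg]
    have : -(rot 2 * walk w * J * rot 1) = J * (rot 0 * walk (false :: w) * J * rot 1) := by
      rw [walk_cons, step, rot_zero, one_mul, mul_assoc J (rot 2)]
      simp only [← mul_assoc, J_mul_J, neg_mul, one_mul]
    rw [this]
  · refine ⟨inner 1 w, ?_, rfl⟩
    rw [val, val, conj_conj, ← conj_neg]
    have : -(rot 1 * walk w * J * rot 1) = J * (rot 0 * walk (true :: w) * J * rot 1) := by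
      rw [walk_cons, step, rot_zero, one_mul, mul_assoc J (rot 1)]
      simp only [← mul_assoc, J_mul_J, neg_mul, one_mul]
    rw [this]

lemma exists_conj_J (f : Code) :
    ∃ f' : Code, f'.val = J * f.val * J⁻¹ ∧ f'.depth ≤ f.depth + 1 := by
  cases f with
  | corner k =>
    fin_cases k
    · exact ⟨corner 2, by decide, Nat.zero_le _⟩
    · exact ⟨inner 0 [], by decide, le_rfl⟩
    · exact ⟨corner 0, by decide, Nat.zero_le _⟩
  | inner i w =>
    have key : ∀ b : Bool, ∀ k, step b = J * rot k →
        (inner 0 (b :: w)).val = J * (inner k w).val * J⁻¹ := by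
      intro b k h
      rw [val, val, conj_conj, walk_cons, h, rot_zero, one_mul]
      simp only [mul_assoc]
    fin_cases i
    · obtain ⟨f', h, h'⟩ := exists_conj_J_inner_zero w
      exact ⟨f', h, by rw [h']; simp only [depth]; omega⟩
    · exact ⟨inner 0 (true :: w), key true 1 rfl, le_rfl⟩
    · exact ⟨inner 0 (false :: w), key false 2 rfl, le_rfl⟩

lemma exists_conj_walk (w : List Bool) (f : Code) :
    ∃ f' : Code, f'.val = walk w * f.val * (walk w)⁻¹ ∧ f'.depth ≤ f.depth + w.length := by
  induction w with
  | nil => exact ⟨f, by simp, le_rfl⟩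
  | cons b w ih =>
    obtain ⟨f₁, h₁, d₁⟩ := ih
    obtain ⟨k, hk⟩ : ∃ k, step b = J * rot k := by cases b <;> exact ⟨_, rfl⟩
    obtain ⟨f₂, h₂, d₂⟩ := exists_conj_rot k f₁
    obtain ⟨f₃, h₃, d₃⟩ := exists_conj_J f₂
    refine ⟨f₃, ?_, by simp only [List.length_cons]; omega⟩
    rw [h₃, h₂, h₁, walk_cons, hk]
    group

lemma exists_plus_eq (f : Code) : ∃ i w, f.plus = rot i * walk w ∧ w.length = f.depth := by
  cases f with
  | corner k => exact ⟨k, [], by simp [plus], rfl⟩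
  | inner i w => exact ⟨i, w ++ [true], rfl, by simp [depth]⟩

lemma exists_minus_eq (f : Code) : ∃ i w, f.minus = rot i * walk w ∧ w.length = f.depth := by
  cases f with
  | corner k => exact ⟨k + 1, [], by simp [minus], rfl⟩
  | inner i w => exact ⟨i, w ++ [false], rfl, by simp [depth]⟩

lemma exists_conj_rot_mul_walk (i : Fin 3) (w : List Bool) (f : Code) :
    ∃ f' : Code, f'.val = rot i * walk w * f.val * (rot i * walk w)⁻¹ ∧
      f'.depth ≤ f.depth + w.length := by
  obtain ⟨f₁, h₁, d₁⟩ := exists_conj_walk w f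
  obtain ⟨f₂, h₂, d₂⟩ := exists_conj_rot i f₁
  exact ⟨f₂, by rw [h₂, h₁]; group, d₂ ▸ d₁⟩

/-- Conjugation by `f` shortens every conjugate of `U` lying behind the repelling half-plane. -/
lemma exists_conj_val (f : Code) (s : List Bool) :
    ∃ h : Code, h.val = f.val * (f.minus * (inner 0 s).val * f.minus⁻¹) * f.val⁻¹ ∧
      h.depth ≤ f.depth + s.length := by
  obtain ⟨i, w, hp, hw⟩ := exists_plus_eq f
  obtain ⟨f₁, h₁, d₁⟩ := exists_conj_J_inner_zero s
  obtain ⟨f₂, h₂, d₂⟩ := exists_conj_rot_mul_walk i w f₁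
  refine ⟨f₂, ?_, by omega⟩
  rw [h₂, h₁, ← hp, val_eq f]
  group

/-- Conjugation by `f⁻¹` shortens every conjugate of `U` lying behind the attracting
half-plane. -/
lemma exists_inv_conj_val (f : Code) (s : List Bool) :
    ∃ h : Code, h.val = f.val⁻¹ * (f.plus * (inner 0 s).val * f.plus⁻¹) * f.val ∧
      h.depth ≤ f.depth + s.length := by
  obtain ⟨i, w, hp, hw⟩ := exists_minus_eq f
  obtain ⟨f₁, h₁, d₁⟩ := exists_conj_J_inner_zero s
  obtain ⟨f₂, h₂, d₂⟩ := exists_conj_rot_mul_walk i w f₁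
  refine ⟨f₂, ?_, by omega⟩
  have hinv : f.val⁻¹ = -(f.minus * J * f.plus⁻¹) := by
    simp [val_eq f, J_inv, mul_assoc]
  have hval : f.val = (-(f.minus * J * f.plus⁻¹))⁻¹ := by rw [← hinv, inv_inv]
  rw [h₂, h₁, ← hp, hinv, hval, conj_neg]
  group

lemma val_inner_append (i : Fin 3) (p s : List Bool) :
    (inner i (p ++ s)).val = rot i * walk p * (inner 0 s).val * (rot i * walk p)⁻¹ := by
  simp only [val, walk_append, rot_zero]
  group

/-- The repelling half-plane of `f` and the attracting half-plane of `g` are disjoint. -/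
def Separated (f g : Code) : Prop := SameSign (J * f.minus⁻¹ * g.plus)

lemma eq_or_extends_or_diverge (u w : List Bool) :
    u = w ∨ (∃ b s, w = u ++ b :: s) ∨ (∃ b s, u = w ++ b :: s) ∨
      ∃ p b s t, u = p ++ b :: s ∧ w = p ++ (!b) :: t := by
  induction u generalizing w with
  | nil => cases w with
    | nil => exact Or.inl rfl
    | cons b w => exact Or.inr (Or.inl ⟨b, w, rfl⟩)
  | cons a u ih => cases w with
    | nil => exact Or.inr (Or.inr (Or.inl ⟨a, u, rfl⟩))
    | cons b w =>
      by_cases hab : a = b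
      · subst hab
        rcases ih w with rfl | ⟨b, s, rfl⟩ | ⟨b, s, rfl⟩ | ⟨p, b, s, t, rfl, rfl⟩
        · exact Or.inl rfl
        · exact Or.inr (Or.inl ⟨b, s, rfl⟩)
        · exact Or.inr (Or.inr (Or.inl ⟨b, s, rfl⟩))
        · exact Or.inr (Or.inr (Or.inr ⟨a :: p, b, s, t, rfl, rfl⟩))
      · obtain rfl : b = !a := by cases a <;> cases b <;> simp_all
        exact Or.inr (Or.inr (Or.inr ⟨[], a, u, w, rfl, rfl⟩))

/-- Two consecutive factors which are not separated either multiply to `VU` or can be shortened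
by a Hurwitz move. -/
lemma separated_or_reducible (f g : Code) :
    Separated f g ∨ (∃ k, f = corner k ∧ g = corner (k + 1)) ∨
      (∃ h : Code, h.val = f.val * g.val * f.val⁻¹ ∧ h.depth < g.depth) ∨
      (∃ h : Code, h.val = g.val⁻¹ * f.val * g.val ∧ h.depth < f.depth) := by
  have right : ∀ s, g.val = f.minus * (inner 0 s).val * f.minus⁻¹ →
      f.depth + s.length < g.depth →
      ∃ h : Code, h.val = f.val * g.val * f.val⁻¹ ∧ h.depth < g.depth := by
    intro s hs hd
    obtain ⟨h, hv, hh⟩ := exists_conj_val f s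
    exact ⟨h, hs ▸ hv, by omega⟩
  have left : ∀ s, f.val = g.plus * (inner 0 s).val * g.plus⁻¹ →
      g.depth + s.length < f.depth →
      ∃ h : Code, h.val = g.val⁻¹ * f.val * g.val ∧ h.depth < f.depth := by
    intro s hs hd
    obtain ⟨h, hv, hh⟩ := exists_inv_conj_val g s
    exact ⟨h, hs ▸ hv, by omega⟩
  have sep : ∀ i j u w, f.minus = rot i * walk u → g.plus = rot j * walk w → i ≠ j →
      Separated f g := by
    intro i j u w hf hg hij
    rw [Separated, hf, hg]
    exact sameSign_of_ne hij u w
  have div : ∀ i p b s t, f.minus = rot i * walk (p ++ b :: s) →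
      g.plus = rot i * walk (p ++ (!b) :: t) → Separated f g := by
    intro i p b s t hf hg
    rw [Separated, hf, hg]
    exact sameSign_of_diverge i p b s t
  rcases f with k | ⟨i, u⟩ <;> rcases g with l | ⟨j, w⟩
  · by_cases h : k + 1 = l
    · exact Or.inr (Or.inl ⟨k, rfl, by rw [h]⟩)
    · exact Or.inl (sep (k + 1) l [] [] (by simp [minus]) (by simp [plus]) h)
  · by_cases h : k + 1 = j
    · subst h
      refine Or.inr (Or.inr (Or.inl (right w ?_ (by simp [depth]))))
      simpa [minus] using val_inner_append (k + 1) [] w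
    · exact Or.inl (sep (k + 1) j [] _ (by simp [minus]) rfl h)
  · by_cases h : i = l
    · subst h
      refine Or.inr (Or.inr (Or.inr (left u ?_ (by simp [depth]))))
      simpa [plus] using val_inner_append i [] u
    · exact Or.inl (sep i l _ [] rfl (by simp [plus]) h)
  · by_cases h : i = j
    · subst h
      rcases eq_or_extends_or_diverge u w with rfl | ⟨b | b, s, rfl⟩ | ⟨b | b, s, rfl⟩ |
        ⟨p, b, s, t, rfl, rfl⟩
      · exact Or.inl (div i u false [] [] rfl rfl)
      · refine Or.inr (Or.inr (Or.inl (right s ?_ (by simp [depth]; omega))))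
        simpa [minus] using val_inner_append i (u ++ [false]) s
      · exact Or.inl (div i u false [] (s ++ [true]) rfl (by simp [plus]))
      · exact Or.inl (div i w false (s ++ [false]) [] (by simp [minus]) rfl)
      · refine Or.inr (Or.inr (Or.inr (left s ?_ (by simp [depth]; omega))))
        simpa [plus] using val_inner_append i (w ++ [true]) s
      · exact Or.inl (div i p b (s ++ [false]) (t ++ [true])
          (by simp [minus]) (by simp [plus]))
    · exact Or.inl (sep i j _ _ rfl rfl h)

/-- The ping-pong argument for consecutively separated factors. -/
lemma prod_eq_of_isChain (f : Code) (l : List Code) (h : List.IsChain Separated (f :: l)) :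
    ∃ j Q, SameSign Q ∧ ((f :: l).map val).prod = f.plus * Q * J * (rot j)⁻¹ := by
  induction l generalizing f with
  | nil =>
    obtain ⟨j, w, hm, -⟩ := exists_minus_eq f
    refine ⟨j, _, (sameSign_walk w).transpose, ?_⟩
    rw [List.map_singleton, List.prod_singleton, val_eq, hm, mul_inv_rev, mul_assoc,
      ← mul_assoc J, J_mul_inv]
    group
  | cons g l ih =>
    rw [List.isChain_cons_cons] at h
    obtain ⟨j, Q, hQ, hprod⟩ := ih g h.2
    rw [List.map_cons, List.prod_cons, hprod, val_eq]
    exact ⟨j, _, SameSign.mul h.1 hQ, by group⟩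

lemma prod_ne_of_isChain (l : List Code) (h : List.IsChain Separated l) :
    (l.map val).prod ≠ V * U := by
  cases l with
  | nil => decide
  | cons f l =>
    intro hVU
    obtain ⟨j, Q, hQ, hprod⟩ := prod_eq_of_isChain f l h
    obtain ⟨i, w, hp, -⟩ := exists_plus_eq f
    have hs : walk w * Q = (rot i)⁻¹ * (V * U) * rot j * J⁻¹ := by
      rw [← hVU, hprod, hp]
      group
    have h0 : ∀ i j, ¬ SameSign ((rot i)⁻¹ * (V * U) * rot j * J⁻¹) := by decide
    exact h0 i j (hs ▸ (sameSign_walk w).mul hQ)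

/-- Conjugates of `U` have codes. -/
lemma exists_code (A : SL2Z) (hA : IsConj U A) : ∃ f : Code, f.val = A := by
  obtain ⟨c, rfl⟩ := isConj_iff.1 hA
  have hc : c ∈ Subgroup.closure ({ModularGroup.S, ModularGroup.T} : Set SL2Z) := by
    rw [SpecialLinearGroup.SL2Z_generators]
    trivial
  have hS : ModularGroup.S = J := by decide
  have hT : ModularGroup.T = J * rot 2 := by decide
  have hS' : ModularGroup.S⁻¹ = -J := by decide
  have hT' : ModularGroup.T⁻¹ = -(rot 1 * J) := by decide
  have base : ∀ f : Code, ∃ f' : Code, f'.val = J * f.val * J⁻¹ := fun f =>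
    (exists_conj_J f).imp fun _ h => h.1
  have base' : ∀ k, ∀ f : Code, ∃ f' : Code, f'.val = rot k * f.val * (rot k)⁻¹ := fun k f =>
    (exists_conj_rot k f).imp fun _ h => h.1
  have key : ∀ f : Code, ∃ f' : Code, f'.val = c * f.val * c⁻¹ := by
    clear hA
    induction hc using Subgroup.closure_induction_left with
    | one => exact fun f => ⟨f, by simp⟩
    | mul_left x hx y hy ih =>
      intro f
      obtain ⟨f₁, h₁⟩ := ih f
      rcases hx with rfl | rfl
      · obtain ⟨f₂, h₂⟩ := base f₁
        exact ⟨f₂, by rw [h₂, h₁, hS]; group⟩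
      · obtain ⟨f₂, h₂⟩ := base' 2 f₁
        obtain ⟨f₃, h₃⟩ := base f₂
        exact ⟨f₃, by rw [h₃, h₂, h₁, hT]; group⟩
    | inv_mul_cancel x hx y hy ih =>
      intro f
      obtain ⟨f₁, h₁⟩ := ih f
      rcases hx with rfl | rfl
      · obtain ⟨f₂, h₂⟩ := base f₁
        exact ⟨f₂, by rw [h₂, h₁, hS', neg_mul, conj_neg]; group⟩
      · obtain ⟨f₂, h₂⟩ := base f₁
        obtain ⟨f₃, h₃⟩ := base' 1 f₂
        exact ⟨f₃, by rw [h₃, h₂, h₁, hT', neg_mul, conj_neg]; group⟩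
  obtain ⟨f, hf⟩ := key (corner 0)
  exact ⟨f, by rw [hf]; simp [val]⟩

section Hurwitz

variable {G : Type*} [Group G]

lemma HurwitzMove.prod_eq {L L' : List G} (h : HurwitzMove L L') : L'.prod = L.prod := by
  obtain ⟨p, a, b, t, rfl, rfl | rfl⟩ := h <;> simp [mul_assoc]

lemma HurwitzMove.length_eq {L L' : List G} (h : HurwitzMove L L') : L'.length = L.length := by
  obtain ⟨p, a, b, t, rfl, rfl | rfl⟩ := h <;> simp

lemma HurwitzEquiv.prod_eq {L L' : List G} (h : HurwitzEquiv L L') : L'.prod = L.prod := by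
  induction h with
  | refl => rfl
  | tail _ h ih => exact (HurwitzMove.prod_eq h).trans ih

lemma HurwitzEquiv.length_eq {L L' : List G} (h : HurwitzEquiv L L') :
    L'.length = L.length := by
  induction h with
  | refl => rfl
  | tail _ h ih => exact (HurwitzMove.length_eq h).trans ih

lemma HurwitzEquiv.cons (c : G) {L L' : List G} (h : HurwitzEquiv L L') :
    HurwitzEquiv (c :: L) (c :: L') := by
  refine Relation.ReflTransGen.lift (c :: ·) ?_ _ _ h
  rintro _ _ ⟨p, a, b, t, rfl, h⟩
  exact ⟨c :: p, a, b, t, rfl, h.imp (by rintro rfl; rfl) (by rintro rfl; rfl)⟩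

lemma hurwitzMove_swap (p : List G) (a b : G) (t : List G) :
    HurwitzMove (p ++ a :: b :: t) (p ++ b :: (b⁻¹ * a * b) :: t) :=
  ⟨p, a, b, t, rfl, Or.inl rfl⟩

lemma hurwitzMove_swap' (p : List G) (a b : G) (t : List G) :
    HurwitzMove (p ++ a :: b :: t) (p ++ (a * b * a⁻¹) :: a :: t) :=
  ⟨p, a, b, t, rfl, Or.inr rfl⟩

/-- A pair of consecutive entries can be moved to the front. -/
lemma exists_hurwitzEquiv_front (p : List G) (a b : G) (t : List G) :
    ∃ D, HurwitzEquiv (p ++ a :: b :: t) (a :: b :: D) := by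
  induction p with
  | nil => exact ⟨t, .refl⟩
  | cons c p ih =>
    obtain ⟨D, hD⟩ := ih
    exact ⟨_, ((HurwitzEquiv.cons c hD).tail (hurwitzMove_swap [] c a (b :: D))).tail
      (hurwitzMove_swap [a] (a⁻¹ * c * a) b D)⟩

end Hurwitz

/-- Two cyclically consecutive corners can be rotated to `(V, U)`. -/
lemma hurwitzEquiv_corner (k : Fin 3) (D : List SL2Z) :
    HurwitzEquiv ((corner k).val :: (corner (k + 1)).val :: D) (V :: U :: D) := by
  have hmove : ∀ k : Fin 3, HurwitzMove ((corner k).val :: (corner (k + 1)).val :: D)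
      ((corner (k + 1)).val :: (corner (k + 1 + 1)).val :: D) := by
    intro k
    have : (corner (k + 1 + 1)).val
        = (corner (k + 1)).val⁻¹ * (corner k).val * (corner (k + 1)).val := by
      revert k
      decide
    rw [this]
    exact hurwitzMove_swap [] _ _ _
  have h2 : HurwitzEquiv ((corner 2).val :: (corner (2 + 1)).val :: D) (V :: U :: D) := by
    have hV : (corner 2).val = V := by decide
    have hU : (corner (2 + 1)).val = U := by decide
    rw [hV, hU]
    exact .refl
  have h1 := Relation.ReflTransGen.head (hmove 1) h2
  have h0 := Relation.ReflTransGen.head (hmove 0) h1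
  fin_cases k
  · exact h0
  · exact h1
  · exact h2

lemma isChain_or_exists {α : Type*} (R : α → α → Prop) (l : List α) :
    List.IsChain R l ∨ ∃ p a b t, l = p ++ a :: b :: t ∧ ¬ R a b := by
  rcases Classical.em (List.IsChain R l) with h | h
  · exact Or.inl h
  · rw [List.isChain_iff_forall_rel_of_append_cons_cons] at h
    push Not at h
    obtain ⟨a, b, p, t, hl, hR⟩ := h
    exact Or.inr ⟨p, a, b, t, hl, hR⟩

lemma exists_hurwitzEquiv (n : ℕ) (l : List Code) (hn : (l.map depth).sum = n)
    (hl : (l.map val).prod = V * U) : ∃ D, HurwitzEquiv (l.map val) (V :: U :: D) := by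
  induction n using Nat.strong_induction_on generalizing l with
  | _ n ih =>
    rcases isChain_or_exists Separated l with h | ⟨p, f, g, t, rfl, h⟩
    · exact absurd hl (prod_ne_of_isChain l h)
    have step : ∀ l' : List Code, (l'.map depth).sum < n →
        HurwitzMove ((p ++ f :: g :: t).map val) (l'.map val) →
        ∃ D, HurwitzEquiv ((p ++ f :: g :: t).map val) (V :: U :: D) := by
      intro l' hd hm
      obtain ⟨D, hD⟩ := ih _ hd l' rfl ((HurwitzMove.prod_eq hm).trans hl)
      exact ⟨D, .head hm hD⟩
    rcases separated_or_reducible f g with h' | ⟨k, rfl, rfl⟩ | ⟨h', hv, hd⟩ | ⟨h', hv, hd⟩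
    · exact absurd h' h
    · obtain ⟨D, hD⟩ := exists_hurwitzEquiv_front (p.map val) (corner k).val
        (corner (k + 1)).val (t.map val)
      exact ⟨D, by
        rw [List.map_append, List.map_cons, List.map_cons]
        exact hD.trans (hurwitzEquiv_corner k D)⟩
    · refine step (p ++ h' :: f :: t) ?_ ?_
      · simp at hn ⊢
        omega
      · simpa [hv] using hurwitzMove_swap' (p.map val) f.val g.val (t.map val)
    · refine step (p ++ g :: h' :: t) ?_ ?_
      · simp at hn ⊢
        omega
      · simpa [hv] using hurwitzMove_swap (p.map val) f.val g.val (t.map val)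

end NormalFactorization

/-- Kodaira type II: any factorization of `VU` into conjugates of `U` has `r ≥ 2` factors and Hurwitz moves bring it to `(V, U, D₃, …, Dᵣ)` with `D₃⋯Dᵣ = 1`. -/
theorem normal_factorization_II (L : List SL2Z)
    (hconj : ∀ A ∈ L, IsConj U A)
    (hprod : L.prod = V * U) :
    2 ≤ L.length ∧
    ∃ D : List SL2Z,
      HurwitzEquiv L ([V, U] ++ D) ∧ D.prod = 1 := by
  obtain ⟨l, rfl⟩ : L ∈ Set.range (List.map NormalFactorization.Code.val) := by
    rw [Set.range_list_map]
    exact fun A hA => NormalFactorization.exists_code A (hconj A hA)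
  obtain ⟨D, hD⟩ := NormalFactorization.exists_hurwitzEquiv _ l rfl hprod
  refine ⟨?_, D, hD, ?_⟩
  · rw [← NormalFactorization.HurwitzEquiv.length_eq hD]
    simp
  · have h := NormalFactorization.HurwitzEquiv.prod_eq hD
    rw [hprod, List.prod_cons, List.prod_cons, ← mul_assoc] at h
    exact mul_eq_left.1 h
end

section
/- Suppose VUV = G_1⋯G_r where each G_i is a conjugate of U in SL(2,ℤ). Then r ≥ 3, and a finite sequence of Hurwitz moves transforms the sequence (G_1,…,G_r) into a sequence (V, U, V, D_4,…,D_r) with D_4⋯D_r = Id (the 2×2 identity matrix). -/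
namespace TwistFactorization

/-! ### Generators of `SL(2,ℤ)` -/

/-- `S = VUV` inverts an edge of the trivalent tree on which `SL(2,ℤ)` acts. -/
def S : SL2Z := V * U * V

/-- `δ = VU` rotates the trivalent tree about its base vertex. -/
def δ : SL2Z := V * U

/-- The third conjugate of `U` whose axis passes through the base vertex. -/
def W : SL2Z := U⁻¹ * V * U

lemma δ_cubed : δ * δ * δ = -1 := by
  ext i j; fin_cases i <;> fin_cases j <;> decide

lemma S_mul_S : S * S = -1 := by
  ext i j; fin_cases i <;> fin_cases j <;> decide

lemma V_eq : V = -(δ * δ * S) := by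
  ext i j; fin_cases i <;> fin_cases j <;> decide

lemma U_eq : U = -(S * δ * δ) := by
  ext i j; fin_cases i <;> fin_cases j <;> decide

lemma W_eq : W = -(δ * S * δ) := by
  ext i j; fin_cases i <;> fin_cases j <;> decide

lemma W_inv_eq : W⁻¹ = δ * δ * S * δ * δ := by
  ext i j; fin_cases i <;> fin_cases j <;> decide

lemma δ_mul_W : δ * W = V * δ := by
  ext i j; fin_cases i <;> fin_cases j <;> decide

lemma δ_mul_V : δ * V = U * δ := by
  ext i j; fin_cases i <;> fin_cases j <;> decide

lemma closure_δ_S : Subgroup.closure {δ, S} = ⊤ := by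
  rw [eq_top_iff, ← SpecialLinearGroup.SL2Z_generators, Subgroup.closure_le]
  have hδ : δ ∈ Subgroup.closure {δ, S} := Subgroup.subset_closure (by simp)
  have hS : S ∈ Subgroup.closure {δ, S} := Subgroup.subset_closure (by simp)
  have h₁ : ModularGroup.S = S⁻¹ := by
    ext i j; fin_cases i <;> fin_cases j <;> decide
  have h₂ : ModularGroup.T = S * δ⁻¹ := by
    ext i j; fin_cases i <;> fin_cases j <;> decide
  rintro _ (rfl | rfl)
  · rw [h₁]; exact inv_mem hS
  · rw [h₂]; exact mul_mem hS (inv_mem hδ)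

/-- A subset of `SL(2,ℤ)` stable under products and inverses is everything as soon as it
contains `δ` and `S`. -/
lemma generator_induction {p : SL2Z → Prop} (hδ : p δ) (hS : p S) (one : p 1)
    (mul : ∀ x y, p x → p y → p (x * y)) (inv : ∀ x, p x → p x⁻¹) (g : SL2Z) : p g := by
  have hg : g ∈ Subgroup.closure {δ, S} := by simp [closure_δ_S]
  induction hg using Subgroup.closure_induction with
  | mem x hx => rcases hx with rfl | rfl <;> assumption
  | one => exact one
  | mul x y _ _ hx hy => exact mul x y hx hy
  | inv x _ hx => exact inv x hx

lemma commute_δ_iff {g : SL2Z} :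
    Commute δ g ↔ g 1 0 = -g 0 1 ∧ g 1 1 = g 0 0 - g 0 1 := by
  have hδ : (δ : Matrix (Fin 2) (Fin 2) ℤ) = !![1, 1; -1, 0] := by decide
  rw [commute_iff_eq, Matrix.SpecialLinearGroup.ext_iff]
  simp only [Matrix.SpecialLinearGroup.coe_mul, hδ]
  simp [Fin.forall_fin_two, Matrix.mul_apply]
  constructor
  · rintro ⟨⟨h1, h2⟩, h3, h4⟩
    constructor <;> linarith
  · rintro ⟨h1, h2⟩
    refine ⟨⟨?_, ?_⟩, ?_, ?_⟩ <;> linarith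

lemma eq_of_commute_δ {g : SL2Z} (hg : Commute δ g) :
    ∃ ε : SL2Z, (ε = 1 ∨ ε = -1) ∧ (g = ε ∨ g = δ * ε ∨ g = δ * δ * ε) := by
  obtain ⟨h₁, h₂⟩ := commute_δ_iff.1 hg
  have hdet := Matrix.det_fin_two g.1
  rw [g.2] at hdet
  change 1 = g 0 0 * g 1 1 - g 0 1 * g 1 0 at hdet
  rw [h₁, h₂] at hdet
  have ha : -1 ≤ g 0 0 ∧ g 0 0 ≤ 1 := by
    constructor <;> nlinarith [sq_nonneg (g 0 0 - 2 * g 0 1)]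
  have hb : -1 ≤ g 0 1 ∧ g 0 1 ≤ 1 := by
    constructor <;> nlinarith [sq_nonneg (2 * g 0 0 - g 0 1)]
  have key : ∀ k : SL2Z, k 0 0 = g 0 0 → k 0 1 = g 0 1 → Commute δ k → g = k := by
    intro k h00 h01 hk
    obtain ⟨k₁, k₂⟩ := commute_δ_iff.1 hk
    ext i j
    fin_cases i <;> fin_cases j <;> simp [*]
  have c : Commute δ δ := Commute.refl δ
  have c1 : Commute δ (-1) := by simp
  obtain ⟨ha₁, ha₂⟩ := ha
  obtain ⟨hb₁, hb₂⟩ := hb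
  generalize g 0 0 = a at *
  generalize g 0 1 = b at *
  interval_cases a <;> interval_cases b <;> simp at hdet
  · exact ⟨-1, .inr rfl, .inr (.inl (key _ (by decide) (by decide) (c.mul_right c1)))⟩
  · exact ⟨-1, .inr rfl, .inl (key _ (by decide) (by decide) c1)⟩
  · exact ⟨-1, .inr rfl,
      .inr (.inr (key _ (by decide) (by decide) ((c.mul_right c).mul_right c1)))⟩
  · exact ⟨1, .inl rfl,
      .inr (.inr (key _ (by decide) (by decide) ((c.mul_right c).mul_right (.one_right _))))⟩
  · exact ⟨1, .inl rfl, .inl (key _ (by decide) (by decide) (.one_right _))⟩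
  · exact ⟨1, .inl rfl, .inr (.inl (key _ (by decide) (by decide) (c.mul_right (.one_right _))))⟩

/-! ### Addresses of vertices -/

/-- The group element spelled by a list of turns. -/
def eval : List (Fin 3) → SL2Z
  | [] => 1
  | e :: t => δ ^ e.val * S * eval t

/-- `l` is the reduced address of the vertex of the trivalent tree to which `g` moves the
base vertex. -/
def IsAddress (l : List (Fin 3)) (g : SL2Z) : Prop :=
  (∀ e ∈ l.tail, e ≠ 0) ∧ ∃ k, Commute δ k ∧ g = eval l * k

/-- The effect of `δ` on addresses. -/
def rot : List (Fin 3) → List (Fin 3)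
  | [] => []
  | e :: t => (e + 1) :: t

/-- The effect of `S` on addresses. -/
def flip : List (Fin 3) → List (Fin 3)
  | 0 :: t => t
  | l => 0 :: l

lemma rot_injective : Function.Injective rot := by
  rintro (_ | ⟨a, s⟩) (_ | ⟨b, t⟩) h <;> simp_all [rot]

lemma flip_of_head_ne {l : List (Fin 3)} (h : ∀ e ∈ l.head?, e ≠ 0) : flip l = 0 :: l := by
  unfold flip
  split
  · simp at h
  · rfl

lemma flip_flip {l : List (Fin 3)} (h : ∀ e ∈ l.tail, e ≠ 0) : flip (flip l) = l := by
  by_cases hl : ∀ e ∈ l.head?, e ≠ 0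
  · rw [flip_of_head_ne hl]; rfl
  · obtain _ | ⟨a, t⟩ := l
    · simp at hl
    · obtain rfl : a = 0 := by simpa using hl
      exact flip_of_head_ne fun e he => h e (List.mem_of_mem_head? he)

lemma IsAddress.neg {l : List (Fin 3)} {g : SL2Z} (h : IsAddress l g) : IsAddress l (-g) := by
  obtain ⟨hl, k, hk, rfl⟩ := h
  exact ⟨hl, -k, hk.neg_right, by simp⟩

lemma IsAddress.rot {l : List (Fin 3)} {g : SL2Z} (h : IsAddress l g) :
    IsAddress (rot l) (δ * g) := by
  obtain ⟨hl, k, hk, rfl⟩ := h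
  obtain _ | ⟨e, t⟩ := l
  · exact ⟨hl, δ * k, (Commute.refl δ).mul_right hk, by simp [eval, TwistFactorization.rot]⟩
  · fin_cases e
    · exact ⟨hl, k, hk, by simp [eval, TwistFactorization.rot, mul_assoc]⟩
    · exact ⟨hl, k, hk, by simp [eval, TwistFactorization.rot, mul_assoc, pow_two]⟩
    · refine ⟨hl, -k, hk.neg_right, ?_⟩
      have := δ_cubed
      simp [eval, TwistFactorization.rot, pow_two, ← mul_assoc, this]

lemma IsAddress.flip {l : List (Fin 3)} {g : SL2Z} (h : IsAddress l g) :
    IsAddress (flip l) (S * g) := by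
  obtain ⟨hl, k, hk, rfl⟩ := h
  by_cases h0 : ∀ e ∈ l.head?, e ≠ 0
  · rw [flip_of_head_ne h0]
    refine ⟨?_, k, hk, by simp [eval, mul_assoc]⟩
    obtain _ | ⟨a, t⟩ := l
    · simp
    · simp_all
  · obtain _ | ⟨a, t⟩ := l
    · simp at h0
    · obtain rfl : a = 0 := by simpa using h0
      refine ⟨fun e he => hl e (List.mem_of_mem_tail he), -k, hk.neg_right, ?_⟩
      simp [eval, TwistFactorization.flip, ← mul_assoc, S_mul_S]

lemma isAddress_one : IsAddress [] 1 := ⟨by simp, 1, .one_right _, by simp [eval]⟩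

lemma exists_isAddress (g : SL2Z) : ∃ l, IsAddress l g := by
  have H : ∀ k h : SL2Z, (∃ l, IsAddress l h) ↔ ∃ l, IsAddress l (k * h) := by
    intro k
    have hδ : ∀ h : SL2Z, (∃ l, IsAddress l h) → ∃ l, IsAddress l (δ * h) :=
      fun h ⟨l, hl⟩ => ⟨_, hl.rot⟩
    have hS : ∀ h : SL2Z, (∃ l, IsAddress l h) → ∃ l, IsAddress l (S * h) :=
      fun h ⟨l, hl⟩ => ⟨_, hl.flip⟩
    have hneg : ∀ h : SL2Z, (∃ l, IsAddress l (-h)) → ∃ l, IsAddress l h :=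
      fun h ⟨l, hl⟩ => ⟨l, by simpa using hl.neg⟩
    induction k using generator_induction with
    | hδ =>
      refine fun h => ⟨hδ h, fun hh => hneg _ ?_⟩
      have := hδ _ (hδ _ hh)
      rwa [← mul_assoc, ← mul_assoc, δ_cubed, neg_one_mul] at this
    | hS =>
      refine fun h => ⟨hS h, fun hh => hneg _ ?_⟩
      have := hS _ hh
      rwa [← mul_assoc, S_mul_S, neg_one_mul] at this
    | one => simp
    | mul x y hx hy => intro h; rw [hy, hx, mul_assoc]
    | inv x hx => intro h; rw [hx (x⁻¹ * h), mul_inv_cancel_left]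
  simpa using (H g 1).1 ⟨_, isAddress_one⟩

/-- Up to a common sign, the first column of `S * eval t` is nonpositive and the second one
nonnegative. -/
lemma eval_signs {t : List (Fin 3)} (ht : ∀ e ∈ t, e ≠ 0) {M : SL2Z} (hM : M = S * eval t) :
    (∀ i j, M i 0 * M j 1 ≤ 0) ∧ 0 ≤ M 0 0 * M 1 0 ∧ 0 ≤ M 0 1 * M 1 1 := by
  induction t generalizing M with
  | nil => subst hM; simp only [eval, mul_one]; decide
  | cons e t ih =>
    obtain ⟨h, h0, h1⟩ := ih (fun e he => ht e (List.mem_cons_of_mem _ he)) rfl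
    generalize hN : S * eval t = N at *
    have hMN : M = S * δ ^ e.val * N := by
      simp only [hM, eval, mul_assoc, hN]
    have h00 := h 0 0
    have h01 := h 0 1
    have h10 := h 1 0
    have h11 := h 1 1
    fin_cases e
    · simp at ht
    · have hM' : ∀ i j, M i j = ((!![-1, 0; -1, -1] : Matrix (Fin 2) (Fin 2) ℤ) * N.1) i j := by
        have : (S * δ ^ 1 : SL2Z).1 = !![-1, 0; -1, -1] := by decide
        intro i j; rw [← this, hMN]; rfl
      simp [hM', Fin.forall_fin_two, Matrix.mul_apply]
      refine ⟨⟨⟨?_, ?_⟩, ?_, ?_⟩, ?_, ?_⟩ <;>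
        nlinarith [mul_self_nonneg (N 0 0), mul_self_nonneg (N 0 1)]
    · have hM' : ∀ i j, M i j = ((!![-1, -1; 0, -1] : Matrix (Fin 2) (Fin 2) ℤ) * N.1) i j := by
        have : (S * δ ^ 2 : SL2Z).1 = !![-1, -1; 0, -1] := by decide
        intro i j; rw [← this, hMN]; rfl
      simp [hM', Fin.forall_fin_two, Matrix.mul_apply]
      refine ⟨⟨⟨?_, ?_⟩, ?_, ?_⟩, ?_, ?_⟩ <;>
        nlinarith [mul_self_nonneg (N 1 0), mul_self_nonneg (N 1 1)]

lemma IsAddress.unique {l l' : List (Fin 3)} {g : SL2Z} (h : IsAddress l g)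
    (h' : IsAddress l' g) : l = l' := by
  induction l generalizing l' g with
  | nil =>
    obtain ⟨-, k, hk, rfl⟩ := h
    obtain ⟨hl', k', hk', hkk'⟩ := h'
    obtain _ | ⟨e, t⟩ := l'
    · rfl
    · exfalso
      have hM : Commute δ (S * eval t) := by
        have : S * eval t = (δ ^ e.val)⁻¹ * k * k'⁻¹ := by
          simp only [eval, one_mul] at hkk'
          rw [hkk']; group
        rw [this]
        exact (((Commute.refl δ).pow_right _).inv_right.mul_right hk).mul_right hk'.inv_right
      obtain ⟨h, -, -⟩ := eval_signs (t := t) hl' rfl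
      obtain ⟨h10, h11⟩ := commute_δ_iff.1 hM
      have hdet := Matrix.det_fin_two (S * eval t).1
      rw [(S * eval t).2] at hdet
      change 1 = (S * eval t) 0 0 * (S * eval t) 1 1 - (S * eval t) 0 1 * (S * eval t) 1 0 at hdet
      have h00 := h 0 0
      have h01 := h 0 1
      have h10' := h 1 0
      have h11' := h 1 1
      rw [h10, h11] at hdet
      rw [h11] at h01
      rw [h10] at h10'
      rw [h10, h11] at h11'
      clear h h10 h11 hM
      generalize (S * eval t) 0 0 = a at *
      generalize (S * eval t) 0 1 = b at *
      nlinarith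
  | cons e t ih =>
    have key : ∀ {m : List (Fin 3)} {g : SL2Z}, IsAddress (0 :: t) g → IsAddress m g →
        0 :: t = m := by
      intro m g h h'
      have := ih (l' := TwistFactorization.flip m) h.flip h'.flip
      rw [← flip_flip h'.1, ← this]
      exact (flip_of_head_ne fun e he => h.1 e (List.mem_of_mem_head? he)).symm
    fin_cases e
    · exact key h h'
    · exact rot_injective (rot_injective (key h.rot.rot h'.rot.rot))
    · exact rot_injective (key h.rot h'.rot)

/-- The reduced address of the image of the base vertex under `g`. -/
noncomputable def addr (g : SL2Z) : List (Fin 3) := (exists_isAddress g).choose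

lemma isAddress_addr (g : SL2Z) : IsAddress (addr g) g := (exists_isAddress g).choose_spec

lemma addr_eq {l : List (Fin 3)} {g : SL2Z} (h : IsAddress l g) : addr g = l :=
  (isAddress_addr g).unique h

@[simp] lemma addr_one : addr 1 = [] := addr_eq isAddress_one

@[simp] lemma addr_neg (g : SL2Z) : addr (-g) = addr g := addr_eq (isAddress_addr g).neg

@[simp] lemma addr_δ_mul (g : SL2Z) : addr (δ * g) = rot (addr g) := addr_eq (isAddress_addr g).rot

@[simp] lemma addr_S_mul (g : SL2Z) : addr (S * g) = flip (addr g) :=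
  addr_eq (isAddress_addr g).flip

lemma commute_of_addr_eq_nil {g : SL2Z} (h : addr g = []) : Commute δ g := by
  obtain ⟨-, k, hk, hg⟩ := isAddress_addr g
  rw [h] at hg
  simpa [hg, eval] using hk

/-! ### The tree metric -/

/-- The length of the longest common prefix of two lists. -/
def lcp : List (Fin 3) → List (Fin 3) → ℕ
  | a :: s, b :: t => if a = b then lcp s t + 1 else 0
  | _, _ => 0

lemma lcp_comm (s t : List (Fin 3)) : lcp s t = lcp t s := by
  induction s generalizing t with
  | nil => cases t <;> rfl
  | cons a s ih => cases t with
    | nil => rfl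
    | cons b t => simp only [lcp, ih t, eq_comm]

lemma lcp_self (s : List (Fin 3)) : lcp s s = s.length := by
  induction s <;> simp_all [lcp]

@[simp] lemma lcp_nil (s : List (Fin 3)) : lcp s [] = 0 := by cases s <;> rfl

lemma min_lcp_le (s t u : List (Fin 3)) : min (lcp s t) (lcp t u) ≤ lcp s u := by
  induction s generalizing t u with
  | nil => cases t <;> simp [lcp]
  | cons a s ih =>
    obtain _ | ⟨b, t⟩ := t
    · simp [lcp]
    obtain _ | ⟨c, u⟩ := u
    · simp
    have := ih t u
    simp only [lcp]
    split_ifs <;> omega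

lemma lcp_rot_add (s t : List (Fin 3)) :
    (rot s).length + (rot t).length + 2 * lcp s t = s.length + t.length + 2 * lcp (rot s) (rot t) := by
  cases s <;> cases t <;> simp [rot, lcp]

lemma lcp_flip_add {s t : List (Fin 3)} (hs : ∀ e ∈ s.tail, e ≠ 0) (ht : ∀ e ∈ t.tail, e ≠ 0) :
    (flip s).length + (flip t).length + 2 * lcp s t =
      s.length + t.length + 2 * lcp (flip s) (flip t) := by
  have cases_head : ∀ {l : List (Fin 3)}, (∀ e ∈ l.tail, e ≠ 0) →
      (flip l = 0 :: l ∧ ∀ e ∈ l.head?, e ≠ 0) ∨ ∃ m, l = 0 :: m ∧ ∀ e ∈ m.head?, e ≠ 0 := by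
    intro l hl
    by_cases h : ∀ e ∈ l.head?, e ≠ 0
    · exact .inl ⟨flip_of_head_ne h, h⟩
    · obtain _ | ⟨a, m⟩ := l
      · simp at h
      · obtain rfl : a = 0 := by simpa using h
        exact .inr ⟨m, rfl, fun e he => hl e (List.mem_of_mem_head? he)⟩
  have mixed : ∀ {l m : List (Fin 3)}, (∀ e ∈ l.head?, e ≠ 0) → lcp (0 :: m) l = 0 := by
    intro l m h
    obtain _ | ⟨a, l⟩ := l
    · simp
    · have : a ≠ 0 := by simpa using h
      simp [lcp, this.symm]
  rcases cases_head hs with ⟨hs, hs'⟩ | ⟨s, rfl, hs'⟩ <;>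
    rcases cases_head ht with ⟨ht, ht'⟩ | ⟨t, rfl, ht'⟩
  · rw [hs, ht]; simp [lcp]; omega
  · rw [hs, lcp_comm, mixed hs', flip, mixed ht']; simp; omega
  · rw [ht, mixed ht', flip, lcp_comm, mixed hs']; simp; omega
  · simp [flip, lcp]; omega

/-- The distance from the base vertex to its image under `g`. -/
noncomputable def len (g : SL2Z) : ℕ := (addr g).length

/-- The length of the common part of the paths from the base vertex to its images
under `g` and `h`. -/
noncomputable def gromov (g h : SL2Z) : ℕ := lcp (addr g) (addr h)

lemma gromov_comm (g h : SL2Z) : gromov g h = gromov h g := lcp_comm _ _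

lemma gromov_self (g : SL2Z) : gromov g g = len g := lcp_self _

lemma min_gromov_le (g h k : SL2Z) : min (gromov g h) (gromov h k) ≤ gromov g k :=
  min_lcp_le _ _ _

@[simp] lemma len_one : len 1 = 0 := by simp [len]

lemma isometry (k g h : SL2Z) :
    len (k * g) + len (k * h) + 2 * gromov g h = len g + len h + 2 * gromov (k * g) (k * h) := by
  induction k using generator_induction generalizing g h with
  | hδ => simpa [len, gromov] using lcp_rot_add (addr g) (addr h)
  | hS => simpa [len, gromov] using lcp_flip_add (isAddress_addr g).1 (isAddress_addr h).1
  | one => simp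
  | mul x y hx hy =>
    have h₁ := hx (y * g) (y * h)
    have h₂ := hy g h
    simp only [mul_assoc]
    omega
  | inv x hx =>
    have := hx (x⁻¹ * g) (x⁻¹ * h)
    simp only [mul_inv_cancel_left] at this
    omega

lemma len_inv_mul (g h : SL2Z) : len (g⁻¹ * h) + 2 * gromov g h = len g + len h := by
  have := isometry g⁻¹ g h
  have h0 : gromov 1 (g⁻¹ * h) = 0 := by simp [gromov, lcp]
  simp [h0] at this
  omega

@[simp] lemma len_inv (g : SL2Z) : len g⁻¹ = len g := by
  have := len_inv_mul g 1
  simpa [gromov] using this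

lemma len_mul (g h : SL2Z) : len (g * h) + 2 * gromov g⁻¹ h = len g + len h := by
  simpa using len_inv_mul g⁻¹ h

/-! ### Conjugates of `U` -/

@[simp] lemma addr_V_mul (g : SL2Z) : addr (V * g) = rot (rot (flip (addr g))) := by
  rw [V_eq]; simp [mul_assoc]

@[simp] lemma addr_U_mul (g : SL2Z) : addr (U * g) = flip (rot (rot (addr g))) := by
  rw [U_eq]; simp [mul_assoc]

@[simp] lemma addr_W_mul (g : SL2Z) : addr (W * g) = rot (flip (rot (addr g))) := by
  rw [W_eq]; simp [mul_assoc]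

@[simp] lemma addr_W_inv_mul (g : SL2Z) :
    addr (W⁻¹ * g) = rot (rot (flip (rot (rot (addr g))))) := by
  rw [W_inv_eq]; simp [mul_assoc]

/-- Every conjugate of `U` is `x * W * x⁻¹` where the path from the base vertex to its image
under `x⁻¹` avoids the axis of `W`. -/
lemma exists_reduced_conj {h : SL2Z} (hh : IsConj U h) :
    ∃ x, h = x * W * x⁻¹ ∧ ∀ e ∈ (addr x⁻¹).head?, e = 0 := by
  have hex : ∃ n x, h = x * W * x⁻¹ ∧ len x⁻¹ = n := by
    obtain ⟨c, rfl⟩ := isConj_iff.1 hh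
    refine ⟨_, c * (δ * δ), ?_, rfl⟩
    have : U * δ * δ = δ * δ * W := by
      rw [← δ_mul_V, mul_assoc, ← δ_mul_W, mul_assoc]
    have h2 : U = δ * δ * W * (δ * δ)⁻¹ := by rw [← this]; group
    rw [h2]; group
  classical
  obtain ⟨x, hx, hn⟩ := Nat.find_spec hex
  refine ⟨x, hx, ?_⟩
  have hmin : ∀ y, h = y * W * y⁻¹ → len x⁻¹ ≤ len y⁻¹ := fun y hy =>
    hn ▸ Nat.find_min' hex ⟨y, hy, rfl⟩
  have h₁ := hmin (x * W⁻¹) (by rw [hx]; group)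
  have h₂ := hmin (x * W) (by rw [hx]; group)
  rw [mul_inv_rev, inv_inv] at h₁
  rw [mul_inv_rev] at h₂
  simp only [len, addr_W_mul, addr_W_inv_mul] at h₁ h₂
  generalize addr x⁻¹ = l at *
  obtain _ | ⟨e, t⟩ := l
  · simp
  · have rot_length : ∀ l, (rot l).length = l.length := by rintro (_ | _) <;> rfl
    fin_cases e
    · simp
    · rw [rot_length, rot_length] at h₂
      simp [rot, flip] at h₂
    · rw [rot_length] at h₁
      simp [rot, flip] at h₁

lemma lcp_cons_one {l m : List (Fin 3)} (h : ∀ e ∈ l.head?, e = 0) : lcp l (1 :: m) = 0 := by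
  obtain _ | ⟨a, l⟩ := l
  · rfl
  · obtain rfl : a = 0 := by simpa using h
    simp [lcp]

lemma addr_W_mul_of_head {g : SL2Z} (h : ∀ e ∈ (addr g).head?, e = 0) :
    (∃ m, addr (W * g) = 1 :: m ∧ m.length = len g) ∧
      ∃ m, addr (W * (W * g)) = 1 :: m ∧ m.length = len g + 1 := by
  simp only [addr_W_mul, len]
  generalize addr g = l at *
  obtain _ | ⟨a, l⟩ := l
  · simp [rot, flip]
  · obtain rfl : a = 0 := by simpa using h
    simp [rot, flip]

/-- The path from the base vertex to its image under a conjugate `h` of `U` goes to the axis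
of `h`, follows it for one step, and leaves it again. -/
lemma exists_conj_path {h : SL2Z} (hh : IsConj U h) :
    ∃ x, h = x * W * x⁻¹ ∧ (∀ e ∈ (addr x⁻¹).head?, e = 0) ∧ len h = 2 * len x + 1 ∧
      gromov h⁻¹ h = len x ∧ gromov x h = len x := by
  obtain ⟨x, hx, hhead⟩ := exists_reduced_conj hh
  obtain ⟨⟨m, hm, hml⟩, m', hm', hml'⟩ := addr_W_mul_of_head hhead
  have h₁ := len_inv_mul x⁻¹ (W * x⁻¹)
  have h₂ := len_inv_mul x⁻¹ (W * (W * x⁻¹))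
  have h₃ := len_mul h h
  have h₄ := len_inv_mul x h
  have e₁ : gromov x⁻¹ (W * x⁻¹) = 0 := by rw [gromov, hm, lcp_cons_one hhead]
  have e₂ : gromov x⁻¹ (W * (W * x⁻¹)) = 0 := by rw [gromov, hm', lcp_cons_one hhead]
  have l₁ : len (W * x⁻¹) = len x + 1 := by rw [len, hm, List.length_cons, hml, len_inv]
  have l₂ : len (W * (W * x⁻¹)) = len x + 2 := by
    rw [len, hm', List.length_cons, hml', len_inv]
  have f₁ : x⁻¹⁻¹ * (W * x⁻¹) = h := by rw [hx]; group
  have f₂ : x⁻¹⁻¹ * (W * (W * x⁻¹)) = h * h := by rw [hx]; group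
  have f₃ : x⁻¹ * h = W * x⁻¹ := by rw [hx]; group
  rw [f₁, e₁, l₁, len_inv] at h₁
  rw [f₂, e₂, l₂, len_inv] at h₂
  rw [f₃, l₁] at h₄
  exact ⟨x, hx, hhead, by omega, by omega, by omega⟩

/-- If the path of `g⁻¹` follows that of `h` beyond the axis of `g`, conjugating `h` by `g`
brings its axis closer to the base vertex. -/
lemma len_conj_lt {g h : SL2Z} (hh : len h ≤ 2 * gromov h⁻¹ h + 1)
    (hg : len g < 2 * gromov g⁻¹ h) (hgh : 2 * gromov g⁻¹ h < len h ∨ len g < len h) :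
    len (g * h * g⁻¹) < len h := by
  have h₁ := len_mul h g⁻¹
  have h₂ := len_mul g (h * g⁻¹)
  have h₃ := len_inv_mul h (h * g⁻¹)
  have u₁ := min_gromov_le g⁻¹ h (h * g⁻¹)
  have u₂ := min_gromov_le h⁻¹ h g⁻¹
  rw [gromov_comm h g⁻¹] at u₂
  rw [inv_mul_cancel_left] at h₃
  rw [← mul_assoc] at h₂
  simp only [len_inv] at h₁ h₂ h₃
  omega

lemma eq_of_common_path {g h x y : SL2Z} (hg : g = y * W * y⁻¹) (hh : h = x * W * x⁻¹)
    (hy : ∀ e ∈ (addr y⁻¹).head?, e = 0) (hx : ∀ e ∈ (addr x⁻¹).head?, e = 0)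
    (hlen : len y = len x) (hpos : len x ≠ 0) (hxy : len x ≤ gromov y x) : g = h := by
  have h0 := len_inv_mul y x
  obtain ⟨k, hk'⟩ : ∃ k, k = y⁻¹ * x := ⟨_, rfl⟩
  rw [← hk'] at h0
  have hk : Commute δ k := commute_of_addr_eq_nil (List.length_eq_zero_iff.1
    (show len k = 0 by omega))
  have hya : addr y⁻¹ = addr (k * x⁻¹) := by rw [hk']; congr 1; group
  rw [← len_inv] at hpos
  simp only [len] at hpos
  obtain ⟨ε, hε, hkε⟩ := eq_of_commute_δ hk
  have hε' : ∀ z, addr (ε * z) = addr z := by rcases hε with rfl | rfl <;> simp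
  rcases hkε with rfl | rfl | rfl
  · obtain rfl : x = y * k := by rw [hk']; group
    rw [hg, hh]; rcases hε with rfl | rfl <;> simp
  all_goals
    exfalso
    simp only [mul_assoc, addr_δ_mul, hε'] at hya
    rw [hya] at hy
    generalize addr x⁻¹ = l at *
    obtain _ | ⟨a, l⟩ := l
    · simp at hpos
    · obtain rfl : a = 0 := by simpa using hx
      simp [rot] at hy

lemma eq_of_len_eq_zero {g x : SL2Z} (hg : g = x * W * x⁻¹) (hx : len x = 0) :
    g = V ∨ g = U ∨ g = W := by
  have hk : Commute δ x := commute_of_addr_eq_nil (List.length_eq_zero_iff.1 hx)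
  obtain ⟨ε, hε, hxε⟩ := eq_of_commute_δ hk
  have hε' : ε * W * ε⁻¹ = W := by rcases hε with rfl | rfl <;> simp
  rcases hxε with rfl | rfl | rfl
  · exact .inr (.inr (hg.trans hε'))
  · left
    calc g = δ * (ε * W * ε⁻¹) * δ⁻¹ := by rw [hg]; group
      _ = V := by rw [hε', δ_mul_W]; group
  · right; left
    calc g = δ * (δ * (ε * W * ε⁻¹)) * δ⁻¹ * δ⁻¹ := by rw [hg]; group
      _ = U := by rw [hε', δ_mul_W, ← mul_assoc, δ_mul_V]; group

lemma eq_of_len_mul_eq_zero {g h : SL2Z} (hg : g = V ∨ g = U ∨ g = W)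
    (hh : h = V ∨ h = U ∨ h = W) (hgh : len (g * h) = 0) :
    g = V ∧ h = U ∨ g = U ∧ h = W ∨ g = W ∧ h = V := by
  have hV : addr V = [2] := by simpa [rot, flip] using addr_V_mul 1
  have hU : addr U = [0] := by simpa [rot, flip] using addr_U_mul 1
  have hW : addr W = [1] := by simpa [rot, flip] using addr_W_mul 1
  rcases hg with rfl | rfl | rfl <;> rcases hh with rfl | rfl | rfl <;>
    simp [len, rot, flip, hV, hU, hW] at hgh ⊢

/-- A pair of conjugates of `U` whose product is not longer than both factors can be shortened
by a Hurwitz move, unless its product is `δ`. -/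
lemma shorten_pair {g h : SL2Z} (hg : IsConj U g) (hh : IsConj U h)
    (hgh : ¬(len g < len (g * h) ∧ len h < len (g * h))) :
    len (g * h * g⁻¹) < len h ∨ len (h⁻¹ * g * h) < len g ∨
      g = V ∧ h = U ∨ g = U ∧ h = W ∨ g = W ∧ h = V := by
  obtain ⟨y, hy, hyhead, hylen, hgg, hyg⟩ := exists_conj_path hg
  obtain ⟨x, hx, hxhead, hxlen, hhh, hxh⟩ := exists_conj_path hh
  have hmul := len_mul g h
  by_cases h₁ : len g < 2 * gromov g⁻¹ h ∧ (2 * gromov g⁻¹ h < len h ∨ len g < len h)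
  · exact .inl (len_conj_lt (by omega) h₁.1 h₁.2)
  by_cases h₂ : len h < 2 * gromov g⁻¹ h ∧ (2 * gromov g⁻¹ h < len g ∨ len h < len g)
  · right; left
    have := len_conj_lt (g := h⁻¹) (h := g⁻¹) (by simp [gromov_comm g, hylen, hgg])
      (by simpa [gromov_comm h] using h₂.1) (by simpa [gromov_comm h] using h₂.2)
    have e : h⁻¹ * g⁻¹ * h⁻¹⁻¹ = (h⁻¹ * g * h)⁻¹ := by group
    rwa [e, len_inv, len_inv] at this
  right; right
  by_cases h0 : len x = 0
  · exact eq_of_len_mul_eq_zero (eq_of_len_eq_zero hy (by omega)) (eq_of_len_eq_zero hx h0)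
      (by omega)
  · exfalso
    have u₁ := min_gromov_le y g g⁻¹
    have u₂ := min_gromov_le y g⁻¹ h
    have u₃ := min_gromov_le y h x
    rw [gromov_comm g g⁻¹] at u₁
    rw [gromov_comm h x] at u₃
    have := eq_of_common_path hy hx hyhead hxhead (by omega) h0 (by omega)
    subst this
    omega

/-- In a sequence of conjugates of `U` that cannot be shortened, the length of the product is
at least the number of factors. -/
lemma length_le_len_prod {g : SL2Z} {w : List SL2Z} (hw : ∀ h ∈ g :: w, IsConj U h)
    (hc : (g :: w).IsChain fun g h => len g < len (g * h) ∧ len h < len (g * h)) :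
    (g :: w).length ≤ len (g :: w).prod ∧ len g < 2 * gromov g (g :: w).prod := by
  induction w generalizing g with
  | nil =>
    obtain ⟨y, -, -, hylen, -⟩ := exists_conj_path (hw g (by simp))
    simp [gromov_self]
    omega
  | cons h w ih =>
    rw [List.isChain_cons_cons] at hc
    obtain ⟨ih₁, ih₂⟩ := ih (fun k hk => hw k (List.mem_cons_of_mem _ hk)) hc.2
    rw [List.prod_cons, List.length_cons]
    generalize (h :: w).prod = P at *
    have h₁ := len_mul g h
    have h₂ := len_mul g P
    have h₃ := len_inv_mul g (g * P)
    rw [inv_mul_cancel_left] at h₃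
    have u := min_gromov_le g⁻¹ P h
    rw [gromov_comm P h] at u
    omega

/-! ### Hurwitz moves -/

section Hurwitz

variable {G : Type*} [Group G]

lemma hurwitzEquiv_append_left (p : List G) {L L' : List G} (h : HurwitzEquiv L L') :
    HurwitzEquiv (p ++ L) (p ++ L') := by
  refine Relation.ReflTransGen.lift (p ++ ·) ?_ _ _ h
  rintro _ _ ⟨q, a, b, t, rfl, rfl | rfl⟩
  · exact ⟨p ++ q, a, b, t, by simp, .inl (by simp)⟩
  · exact ⟨p ++ q, a, b, t, by simp, .inr (by simp)⟩

lemma hurwitzEquiv_pair_right (p : List G) (a b : G) (t : List G) :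
    HurwitzEquiv (p ++ a :: b :: t) (p ++ b :: (b⁻¹ * a * b) :: t) :=
  .single ⟨p, a, b, t, rfl, .inl rfl⟩

lemma hurwitzEquiv_pair_left (p : List G) (a b : G) (t : List G) :
    HurwitzEquiv (p ++ a :: b :: t) (p ++ (a * b * a⁻¹) :: a :: t) :=
  .single ⟨p, a, b, t, rfl, .inr rfl⟩

lemma hurwitzEquiv_move_front (p : List G) (a : G) (t : List G) :
    HurwitzEquiv (p ++ a :: t) (a :: p.map (fun x => a⁻¹ * x * a) ++ t) := by
  induction p with
  | nil => exact .refl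
  | cons x p ih =>
    exact (hurwitzEquiv_append_left [x] ih).trans (hurwitzEquiv_pair_right [] x a _)

lemma prod_eq_of_hurwitzEquiv {L L' : List G} (h : HurwitzEquiv L L') : L.prod = L'.prod := by
  induction h with
  | refl => rfl
  | tail _ h ih =>
    obtain ⟨p, a, b, t, rfl, rfl | rfl⟩ := h <;> simp [ih, mul_assoc]

lemma length_eq_of_hurwitzEquiv {L L' : List G} (h : HurwitzEquiv L L') :
    L.length = L'.length := by
  induction h with
  | refl => rfl
  | tail _ h ih =>
    obtain ⟨p, a, b, t, rfl, rfl | rfl⟩ := h <;> simp [ih]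

end Hurwitz

/-- The sequence `(V, U, V, U, …, V, U)` of `2 * n` matrices. -/
def pairs : ℕ → List SL2Z
  | 0 => []
  | n + 1 => V :: U :: pairs n

lemma prod_pairs (n : ℕ) : (pairs n).prod = δ ^ n := by
  induction n with
  | zero => rfl
  | succ n ih => simp [pairs, ih, pow_succ', δ, mul_assoc]

lemma isConj_conj {g : SL2Z} (hg : IsConj U g) (c : SL2Z) : IsConj U (c * g * c⁻¹) :=
  hg.trans (isConj_iff.2 ⟨c, rfl⟩)

lemma isConj_inv_conj {g : SL2Z} (hg : IsConj U g) (c : SL2Z) : IsConj U (c⁻¹ * g * c) := by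
  simpa using isConj_conj hg c⁻¹

lemma hurwitzEquiv_V_U (p : List SL2Z) {g h : SL2Z} (t : List SL2Z)
    (hgh : g = V ∧ h = U ∨ g = U ∧ h = W ∨ g = W ∧ h = V) :
    HurwitzEquiv (p ++ g :: h :: t) (p ++ V :: U :: t) := by
  rcases hgh with ⟨rfl, rfl⟩ | ⟨rfl, rfl⟩ | ⟨rfl, rfl⟩
  · exact .refl
  · have : U * W * U⁻¹ = V := by rw [W]; group
    simpa [this] using hurwitzEquiv_pair_left p U W t
  · have : V⁻¹ * W * V = U := by
      ext i j; fin_cases i <;> fin_cases j <;> decide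
    simpa [this] using hurwitzEquiv_pair_right p W V t

/-- Hurwitz moves bring every sequence of conjugates of `U` to a sequence of pairs `(V, U)`
followed by a sequence that cannot be shortened. -/
lemma exists_normal_form (L : List SL2Z) (hL : ∀ A ∈ L, IsConj U A) :
    ∃ n w, HurwitzEquiv L (pairs n ++ w) ∧ (∀ A ∈ w, IsConj U A) ∧
      w.IsChain fun g h => len g < len (g * h) ∧ len h < len (g * h) := by
  induction hr : L.length using Nat.strong_induction_on generalizing L with
  | _ r ihr =>
  induction hs : (L.map len).sum using Nat.strong_induction_on generalizing L with
  | _ s ihs =>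
  by_cases hc : L.IsChain fun g h => len g < len (g * h) ∧ len h < len (g * h)
  · exact ⟨0, L, .refl, hL, hc⟩
  rw [List.isChain_iff_forall_rel_of_append_cons_cons] at hc
  push Not at hc
  obtain ⟨g, h, p, t, rfl, hgh⟩ := hc
  have hp : ∀ A ∈ p, IsConj U A := fun A hA => hL A (by simp [hA])
  have ht : ∀ A ∈ t, IsConj U A := fun A hA => hL A (by simp [hA])
  have hg : IsConj U g := hL g (by simp)
  have hh : IsConj U h := hL h (by simp)
  have step : ∀ a b : SL2Z, IsConj U a → IsConj U b → len a + len b < len g + len h →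
      HurwitzEquiv (p ++ g :: h :: t) (p ++ a :: b :: t) →
      ∃ n w, HurwitzEquiv (p ++ g :: h :: t) (pairs n ++ w) ∧ (∀ A ∈ w, IsConj U A) ∧
        w.IsChain fun g h => len g < len (g * h) ∧ len h < len (g * h) := by
    intro a b ha hb hlt hmove
    obtain ⟨n, w, hw, hw'⟩ := ihs _ (by simp at hs ⊢; omega) (p ++ a :: b :: t)
      (by
        simp only [List.mem_append, List.mem_cons]
        rintro A (hA | rfl | rfl | hA)
        exacts [hp A hA, ha, hb, ht A hA]) (by simpa using hr) rfl
    exact ⟨n, w, hmove.trans hw, hw'⟩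
  rcases shorten_pair hg hh (by simpa using hgh) with hlt | hlt | hVU
  · exact step _ _ (isConj_conj hh g) hg (by omega) (hurwitzEquiv_pair_left p g h t)
  · exact step _ _ hh (isConj_inv_conj hg h) (by omega) (hurwitzEquiv_pair_right p g h t)
  · obtain ⟨n, w, hw, hw'⟩ := ihr _ (by simp at hr; simp; omega)
      ((p.map fun x => V⁻¹ * x * V).map (fun x => U⁻¹ * x * U) ++ t)
      (by
        simp only [List.mem_append, List.mem_map]
        rintro _ (⟨_, ⟨x, hx, rfl⟩, rfl⟩ | hA)
        · exact isConj_inv_conj (isConj_inv_conj (hp x hx) V) U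
        · exact ht _ hA) rfl
    refine ⟨n + 1, w, ?_, hw'⟩
    refine (hurwitzEquiv_V_U p t hVU).trans ((hurwitzEquiv_move_front p V (U :: t)).trans ?_)
    refine (hurwitzEquiv_append_left [V] (hurwitzEquiv_move_front _ U t)).trans ?_
    exact hurwitzEquiv_append_left [V, U] hw

lemma not_isConj_U_S : ¬IsConj U S := by
  intro h
  obtain ⟨c, hc⟩ := isConj_iff.1 h
  have hsq : (c * U * c⁻¹) * (c * U * c⁻¹) = -1 := by rw [hc, S_mul_S]
  have : U * U = -1 := by
    calc U * U = c⁻¹ * ((c * U * c⁻¹) * (c * U * c⁻¹)) * c := by group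
      _ = -1 := by rw [hsq]; simp
  exact absurd (congrArg (fun M : SL2Z => M 0 1) this) (by decide)

lemma exists_hurwitzEquiv_VUV {L : List SL2Z} (hL : ∀ A ∈ L, IsConj U A) (hprod : L.prod = S) :
    ∃ D, HurwitzEquiv L ([V, U, V] ++ D) := by
  obtain ⟨n, w, hLw, hw, hc⟩ := exists_normal_form L hL
  have hp : S = δ ^ n * w.prod := by
    rw [← hprod, prod_eq_of_hurwitzEquiv hLw, List.prod_append, prod_pairs]
  have hlen : w.length ≤ 1 := by
    have h1 : len w.prod = 1 := by
      have hδ : ∀ g, len (δ * g) = len g := by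
        intro g
        simp only [len, addr_δ_mul]
        cases addr g <;> rfl
      have hδn : ∀ (k : ℕ) (g : SL2Z), len (δ ^ k * g) = len g := by
        intro k g
        induction k with
        | zero => simp
        | succ k ih => rw [pow_succ', mul_assoc, hδ, ih]
      rw [← hδn n, ← hp, ← mul_one S, len, addr_S_mul, addr_one]
      rfl
    cases w with
    | nil => simp
    | cons g w => exact h1 ▸ (length_le_len_prod hw hc).1
  match n, w with
  | n + 2, w => exact ⟨U :: pairs n ++ w, hLw⟩
  | 1, [] =>
    refine absurd hp ?_
    intro h
    exact absurd (congrArg (fun M : SL2Z => M 0 0) h) (by decide)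
  | 1, [g] =>
    obtain rfl : g = V := by simpa [S, δ] using hp.symm
    exact ⟨[], hLw⟩
  | 0, [] => exact absurd (congrArg (fun M : SL2Z => M 0 0) hp) (by decide)
  | 0, [g] =>
    obtain rfl : S = g := by simpa using hp
    exact absurd (hw S (by simp)) not_isConj_U_S
  | _, _ :: _ :: _ => simp at hlen

end TwistFactorization

/-- Kodaira type III: any factorization of `VUV` into conjugates of `U` has `r ≥ 3` factors and Hurwitz moves bring it to `(V, U, V, D₄, …, Dᵣ)` with `D₄⋯Dᵣ = 1`. -/
theorem normal_factorization_III (L : List SL2Z)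
    (hconj : ∀ A ∈ L, IsConj U A)
    (hprod : L.prod = V * U * V) :
    3 ≤ L.length ∧
    ∃ D : List SL2Z,
      HurwitzEquiv L ([V, U, V] ++ D) ∧ D.prod = 1 := by
  obtain ⟨D, hD⟩ := TwistFactorization.exists_hurwitzEquiv_VUV hconj hprod
  refine ⟨by simp [TwistFactorization.length_eq_of_hurwitzEquiv hD], D, hD, ?_⟩
  have h := TwistFactorization.prod_eq_of_hurwitzEquiv hD
  rw [hprod, List.prod_append] at h
  simpa [mul_assoc] using h
end

section
/- Let n ≥ 0 and suppose -U^n = G_1⋯G_r where each G_i is a conjugate of U in SL(2,ℤ). Then r ≥ n + 6, and a finite sequence of Hurwitz moves transforms the sequence (G_1,…,G_r) into a sequence (C_1,…,C_n,D_{n+1},…,D_r) with C_1 = ⋯ = C_n = U and D_{n+1}⋯D_r = -Id (minus the 2×2 identity matrix). -/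
instance : Fact (Even (Fintype.card (Fin 2))) := ⟨by simp⟩

namespace HurwitzSL2Z

/-- The standard action of `SL(2,ℤ)` on `ℤ²`. -/
def act (g : SL2Z) (y : ℤ × ℤ) : ℤ × ℤ :=
  (g.1 0 0 * y.1 + g.1 0 1 * y.2, g.1 1 0 * y.1 + g.1 1 1 * y.2)

theorem act_mul (g h : SL2Z) (y : ℤ × ℤ) : act (g * h) y = act g (act h y) := by
  simp only [act, Matrix.SpecialLinearGroup.coe_mul, Matrix.mul_apply, Fin.sum_univ_two]
  ext <;> ring

theorem act_one (y : ℤ × ℤ) : act 1 y = y := by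
  simp [act]

theorem act_neg (g : SL2Z) (y : ℤ × ℤ) : act (-g) y = -act g y := by
  simp only [act, Matrix.SpecialLinearGroup.coe_neg, Matrix.neg_apply]
  ext <;> simp <;> ring

/-- The element `[[0,-1],[1,0]]` of order four. -/
def S : SL2Z := ⟨!![0, -1; 1, 0], by norm_num [Matrix.det_fin_two_of]⟩

/-- The element `U * V` of order six. -/
def D : SL2Z := ⟨!![0, 1; -1, 1], by norm_num [Matrix.det_fin_two_of]⟩

theorem S_mul_S : S * S = -1 := by
  decide

theorem D_mul_D_mul_D : D * D * D = -1 := by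
  decide

theorem S_inv : S⁻¹ = -S := by
  rw [inv_eq_iff_mul_eq_one, mul_neg, S_mul_S, neg_neg]

theorem D_inv : D⁻¹ = -(D * D) := by
  rw [inv_eq_iff_mul_eq_one, mul_neg, ← mul_assoc, D_mul_D_mul_D, neg_neg]

theorem U_eq : U = D * D * S := by
  decide

theorem act_S (y : ℤ × ℤ) : act S y = (-y.2, y.1) := by
  simp [act, S]

theorem act_D (y : ℤ × ℤ) : act D y = (y.2, y.2 - y.1) := by
  simp [act, D]; ring

theorem act_S_inv (y : ℤ × ℤ) : act S⁻¹ y = (y.2, -y.1) := by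
  rw [S_inv, act_neg, act_S]; simp

theorem act_D_inv (y : ℤ × ℤ) : act D⁻¹ y = (y.1 - y.2, y.1) := by
  rw [D_inv, act_neg, act_mul, act_D, act_D]; simp

theorem act_U (y : ℤ × ℤ) : act U y = (y.1 + y.2, y.2) := by
  simp [act, U]

theorem act_U_pow (n : ℕ) (y : ℤ × ℤ) : act (U ^ n) y = (y.1 + n * y.2, y.2) := by
  induction n with
  | zero => simp [act_one]
  | succ k ih => rw [pow_succ', act_mul, ih, act_U]; push_cast; ext <;> simp; ring

/-- Vectors whose coordinates have opposite signs, the negative cone. -/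
def IsNeg (y : ℤ × ℤ) : Prop := y.1 * y.2 < 0

/-- Vectors whose coordinates have the same sign, the positive cone. -/
def IsPos (y : ℤ × ℤ) : Prop := 0 < y.1 * y.2

theorem IsPos.apply_S_inv {y : ℤ × ℤ} (h : IsPos y) : IsNeg (act S⁻¹ y) := by
  simp only [IsNeg, IsPos, act_S_inv] at *; nlinarith

theorem IsPos.apply_S {y : ℤ × ℤ} (h : IsPos y) : IsNeg (act S y) := by
  simp only [IsNeg, IsPos, act_S] at *; nlinarith

theorem IsNeg.apply_D {y : ℤ × ℤ} (h : IsNeg y) : IsPos (act D y) := by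
  simp only [IsNeg, IsPos, act_D] at *; nlinarith [sq_nonneg y.2]

theorem IsNeg.apply_D_inv {y : ℤ × ℤ} (h : IsNeg y) : IsPos (act D⁻¹ y) := by
  simp only [IsNeg, IsPos, act_D_inv] at *; nlinarith [sq_nonneg y.1]

theorem IsPos.act_neg {g : SL2Z} {y : ℤ × ℤ} (h : IsPos (act g y)) : IsPos (act (-g) y) := by
  simpa [IsPos, HurwitzSL2Z.act_neg] using h

theorem IsNeg.act_neg {g : SL2Z} {y : ℤ × ℤ} (h : IsNeg (act g y)) : IsNeg (act (-g) y) := by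
  simpa [IsNeg, HurwitzSL2Z.act_neg] using h

theorem D_mul_D : D * D = -D⁻¹ := by rw [D_inv, neg_neg]

theorem D_inv_mul_D_inv : D⁻¹ * D⁻¹ = -D := by
  rw [← mul_inv_rev, D_mul_D, inv_eq_iff_mul_eq_one]; simp

theorem IsNeg.apply_D_mul_D {y : ℤ × ℤ} (h : IsNeg y) : IsPos (act (D * D) y) := by
  rw [D_mul_D]; exact IsPos.act_neg h.apply_D_inv

theorem IsNeg.apply_D_inv_mul_D_inv {y : ℤ × ℤ} (h : IsNeg y) : IsPos (act (D⁻¹ * D⁻¹) y) := by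
  rw [D_inv_mul_D_inv]; exact IsPos.act_neg h.apply_D

/-- Reduced words in `S` and `D`, beginning and ending with `S`, with their number of letters
`S`. -/
inductive InnerWord : ℕ → SL2Z → Prop
  | single : InnerWord 1 S
  | consD {k x} : InnerWord k x → InnerWord (k + 1) (S * (D * x))
  | consD_inv {k x} : InnerWord k x → InnerWord (k + 1) (S * (D⁻¹ * x))

/-- Representatives of the powers of `D` up to sign. -/
inductive Rotation : SL2Z → Prop
  | one : Rotation 1
  | turn : Rotation D
  | turn_inv : Rotation D⁻¹

/-- Reduced words in `S` and `D` not ending with `S * D` or `S * D⁻¹`, with their number of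
letters `S`. -/
inductive ReducedWord : ℕ → SL2Z → Prop
  | short {c} : Rotation c → ReducedWord 0 c
  | long {c k x} : Rotation c → InnerWord k x → ReducedWord k (c * x)

/-- The conjugate of `D * S * D` (hence of `U`) by `g`. -/
def twist (g : SL2Z) : SL2Z := g * (D * S * D) * g⁻¹

theorem twist_neg (g : SL2Z) : twist (-g) = twist g := by
  have : (-g)⁻¹ = -g⁻¹ := by rw [inv_eq_iff_mul_eq_one]; simp
  simp [twist, this]

theorem twist_mul (g h : SL2Z) : twist (g * h) = g * twist h * g⁻¹ := by
  simp only [twist]; group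

theorem twist_D : twist D = U := by
  rw [twist, U_eq]; group

theorem twist_S_mul_D : twist (S * D) = twist D⁻¹ := by
  decide

theorem twist_S_mul_D_inv : twist (S * D⁻¹) = twist D := by
  decide

/-- `A` is a twist along a reduced word with at most `k` letters `S`. -/
def CostLE (k : ℕ) (A : SL2Z) : Prop := ∃ l ≤ k, ∃ g, ReducedWord l g ∧ A = twist g

theorem CostLE.mono {k l : ℕ} {A : SL2Z} (h : CostLE k A) (hkl : k ≤ l) : CostLE l A := by
  obtain ⟨m, hm, h⟩ := h
  exact ⟨m, hm.trans hkl, h⟩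

theorem twist_S_mul_S_mul (x : SL2Z) : twist (S * (S * x)) = twist x := by
  rw [← mul_assoc, S_mul_S, neg_one_mul, twist_neg]

theorem twist_D_mul_D_mul (x : SL2Z) : twist (D * (D * x)) = twist (D⁻¹ * x) := by
  rw [← mul_assoc, D_mul_D, neg_mul, twist_neg]

theorem twist_D_inv_mul_D_inv_mul (x : SL2Z) : twist (D⁻¹ * (D⁻¹ * x)) = twist (D * x) := by
  rw [← mul_assoc, D_inv_mul_D_inv, neg_mul, twist_neg]

theorem twist_D_mul_D : twist (D * D) = twist D⁻¹ := by
  rw [D_mul_D, twist_neg]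

theorem twist_S_inv_mul (x : SL2Z) : twist (S⁻¹ * x) = twist (S * x) := by
  rw [S_inv, neg_mul, twist_neg]

theorem InnerWord.reducedWord {k : ℕ} {x : SL2Z} (h : InnerWord k x) : ReducedWord k x := by
  simpa using ReducedWord.long .one h

theorem ReducedWord.costLE {k : ℕ} {g : SL2Z} (h : ReducedWord k g) : CostLE k (twist g) :=
  ⟨k, le_rfl, g, h, rfl⟩

theorem InnerWord.costLE {k : ℕ} {x : SL2Z} (h : InnerWord k x) : CostLE k (twist x) :=
  h.reducedWord.costLE

theorem ReducedWord.costLE_D_mul {k : ℕ} {g : SL2Z} (h : ReducedWord k g) :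
    CostLE k (twist (D * g)) := by
  cases h with
  | short hc =>
    cases hc with
    | one => simpa using (ReducedWord.short .turn).costLE
    | turn => rw [twist_D_mul_D]; exact (ReducedWord.short .turn_inv).costLE
    | turn_inv => simpa using (ReducedWord.short .one).costLE
  | long hc hx =>
    cases hc with
    | one => simpa using (ReducedWord.long .turn hx).costLE
    | turn => rw [twist_D_mul_D_mul]; exact (ReducedWord.long .turn_inv hx).costLE
    | turn_inv => simpa [mul_assoc] using hx.costLE

theorem ReducedWord.costLE_D_inv_mul {k : ℕ} {g : SL2Z} (h : ReducedWord k g) :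
    CostLE k (twist (D⁻¹ * g)) := by
  obtain ⟨l, hl, g', hg', e⟩ := h.costLE_D_mul
  rw [← twist_D_mul_D_mul, twist_mul, e, ← twist_mul]
  exact hg'.costLE_D_mul.mono hl

theorem InnerWord.costLE_S_mul {k : ℕ} {x : SL2Z} (h : InnerWord (k + 1) x) :
    CostLE k (twist (S * x)) := by
  cases h with
  | single => simpa [S_mul_S, twist_neg] using (ReducedWord.short .one).costLE
  | consD h => rw [twist_S_mul_S_mul]; exact (ReducedWord.long .turn h).costLE
  | consD_inv h => rw [twist_S_mul_S_mul]; exact (ReducedWord.long .turn_inv h).costLE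

theorem ReducedWord.costLE_S_mul {k : ℕ} {g : SL2Z} (h : ReducedWord k g) :
    CostLE (k + 1) (twist (S * g)) := by
  cases h with
  | short hc =>
    cases hc with
    | one => simpa using InnerWord.single.costLE
    | turn => rw [twist_S_mul_D]; exact (ReducedWord.short .turn_inv).costLE.mono (by simp)
    | turn_inv => rw [twist_S_mul_D_inv]; exact (ReducedWord.short .turn).costLE.mono (by simp)
  | long hc hx =>
    cases hc with
    | one =>
      rw [one_mul]
      cases k with
      | zero => cases hx
      | succ k => exact hx.costLE_S_mul.mono (by omega)
    | turn => exact (InnerWord.consD hx).costLE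
    | turn_inv => exact (InnerWord.consD_inv hx).costLE

theorem CostLE.conj_D {k : ℕ} {A : SL2Z} (h : CostLE k A) : CostLE k (D * A * D⁻¹) := by
  obtain ⟨l, hl, g, hg, rfl⟩ := h
  rw [← twist_mul]
  exact hg.costLE_D_mul.mono hl

theorem CostLE.conj_D_inv {k : ℕ} {A : SL2Z} (h : CostLE k A) : CostLE k (D⁻¹ * A * D) := by
  obtain ⟨l, hl, g, hg, rfl⟩ := h
  have := hg.costLE_D_inv_mul.mono hl
  rwa [twist_mul, inv_inv] at this

theorem CostLE.conj_S {k : ℕ} {A : SL2Z} (h : CostLE k A) : CostLE (k + 1) (S * A * S⁻¹) := by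
  obtain ⟨l, hl, g, hg, rfl⟩ := h
  rw [← twist_mul]
  exact hg.costLE_S_mul.mono (by omega)

theorem CostLE.conj_S_inv {k : ℕ} {A : SL2Z} (h : CostLE k A) : CostLE (k + 1) (S⁻¹ * A * S) := by
  have := h.conj_S
  rw [S_inv] at *
  simpa using this

theorem exists_costLE_of_isConj {A : SL2Z} (h : IsConj U A) : ∃ k, CostLE k A := by
  obtain ⟨g, rfl⟩ := isConj_iff.1 h
  have hg : g ∈ Subgroup.closure {ModularGroup.S, ModularGroup.T} := by
    rw [SpecialLinearGroup.SL2Z_generators]; trivial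
  have hS : ModularGroup.S = S := by decide
  have hT : ModularGroup.T = D * D * S := by decide
  rw [hS, hT] at hg
  suffices ∀ B, (∃ k, CostLE k B) → ∃ k, CostLE k (g * B * g⁻¹) from
    this U ⟨0, 0, le_rfl, D, .short .turn, twist_D.symm⟩
  clear h
  induction hg using Subgroup.closure_induction'' with
  | one => simp
  | mem x hx =>
    rintro B ⟨k, hB⟩
    rcases hx with rfl | rfl
    · exact ⟨_, hB.conj_S⟩
    · exact ⟨_, by simpa [mul_assoc] using hB.conj_S.conj_D.conj_D⟩
  | inv_mem x hx =>
    rintro B ⟨k, hB⟩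
    rcases hx with rfl | rfl
    · exact ⟨_, by simpa using hB.conj_S_inv⟩
    · exact ⟨_, by simpa [mul_assoc] using hB.conj_D_inv.conj_D_inv.conj_S_inv⟩
  | mul x y _ _ hx hy =>
    intro B hB
    simpa [mul_assoc] using hx _ (hy B hB)

theorem InnerWord.costLE_mul {k l : ℕ} {x g : SL2Z} (hx : InnerWord k x) (hg : CostLE l (twist g)) :
    CostLE (k + l) (twist (x * g)) := by
  induction hx with
  | single => rw [twist_mul]; exact hg.conj_S.mono (by omega)
  | consD _ ih => rw [twist_mul] at ih ⊢; simpa [mul_assoc] using ih.conj_D.conj_S.mono (by omega)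
  | consD_inv _ ih =>
    rw [twist_mul] at ih ⊢
    simpa [mul_assoc] using ih.conj_D_inv.conj_S.mono (by omega)

theorem ReducedWord.costLE_mul {k l : ℕ} {x g : SL2Z} (hx : ReducedWord k x)
    (hg : CostLE l (twist g)) : CostLE (k + l) (twist (x * g)) := by
  have rot {c m y} (hc : Rotation c) (hy : CostLE m (twist y)) : CostLE m (twist (c * y)) := by
    rw [twist_mul]
    cases hc with
    | one => simpa using hy
    | turn => exact hy.conj_D
    | turn_inv => simpa using hy.conj_D_inv
  cases hx with
  | short hc => exact (rot hc hg).mono (by omega)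
  | long hc hx => rw [mul_assoc]; exact rot hc (hx.costLE_mul hg)

theorem InnerWord.isNeg_act {k : ℕ} {x : SL2Z} (hx : InnerWord k x) {y : ℤ × ℤ} (hy : IsPos y) :
    IsNeg (act x y) := by
  induction hx with
  | single => exact hy.apply_S
  | consD _ ih => simpa only [act_mul] using ih.apply_D.apply_S
  | consD_inv _ ih => simpa only [act_mul] using ih.apply_D_inv.apply_S

theorem InnerWord.isNeg_act_inv {k : ℕ} {x : SL2Z} (hx : InnerWord k x) {y : ℤ × ℤ}
    (hy : IsPos y) : IsNeg (act x⁻¹ y) := by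
  induction hx generalizing y with
  | single => exact hy.apply_S_inv
  | consD _ ih =>
    simpa only [mul_inv_rev, act_mul] using ih hy.apply_S_inv.apply_D_inv
  | consD_inv _ ih =>
    simpa only [mul_inv_rev, inv_inv, act_mul] using ih hy.apply_S_inv.apply_D

/-- The action of `D * g⁻¹ * h * D` maps the negative cone into the positive cone. -/
def Good (g h : SL2Z) : Prop := ∀ z, IsNeg z → IsPos (act (D * (g⁻¹ * (h * D))) z)

theorem good_mul_left_iff {c g h : SL2Z} : Good (c * g) (c * h) ↔ Good g h := by
  simp [Good, mul_assoc]

/-- `h` extends `g` by `D⁻¹` times an inner word. -/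
def ExtendsRight (k : ℕ) (g : SL2Z) (l : ℕ) (h : SL2Z) : Prop :=
  ∃ m x, InnerWord m x ∧ l = k + m ∧ twist h = twist (g * (D⁻¹ * x))

/-- `g` extends `h` by `D` times an inner word. -/
def ExtendsLeft (k : ℕ) (g : SL2Z) (l : ℕ) (h : SL2Z) : Prop :=
  ∃ m x, InnerWord m x ∧ k = l + m ∧ twist g = twist (h * (D * x))

theorem ExtendsRight.mul_left {k l : ℕ} {g h : SL2Z} (H : ExtendsRight k g l h) (c : SL2Z) (n : ℕ) :
    ExtendsRight (k + n) (c * g) (l + n) (c * h) := by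
  obtain ⟨m, x, hx, rfl, e⟩ := H
  exact ⟨m, x, hx, by omega, by rw [twist_mul, e, ← twist_mul, mul_assoc]⟩

theorem ExtendsLeft.mul_left {k l : ℕ} {g h : SL2Z} (H : ExtendsLeft k g l h) (c : SL2Z) (n : ℕ) :
    ExtendsLeft (k + n) (c * g) (l + n) (c * h) := by
  obtain ⟨m, x, hx, rfl, e⟩ := H
  exact ⟨m, x, hx, by omega, by rw [twist_mul, e, ← twist_mul, mul_assoc]⟩

theorem InnerWord.good_or_extends {k l : ℕ} {x y : SL2Z} (hx : InnerWord k x)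
    (hy : InnerWord l y) : Good x y ∨ ExtendsRight k x l y ∨ ExtendsLeft k x l y := by
  have step {m n u v} (c : SL2Z)
      (h : Good u v ∨ ExtendsRight m u n v ∨ ExtendsLeft m u n v) :
      Good (S * (c * u)) (S * (c * v)) ∨
        ExtendsRight (m + 1) (S * (c * u)) (n + 1) (S * (c * v)) ∨
        ExtendsLeft (m + 1) (S * (c * u)) (n + 1) (S * (c * v)) :=
    h.imp (fun h => good_mul_left_iff.2 (good_mul_left_iff.2 h))
      (Or.imp (fun h => (h.mul_left c 0).mul_left S 1) (fun h => (h.mul_left c 0).mul_left S 1))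
  induction hx generalizing l y with
  | single =>
    cases hy with
    | single =>
      refine .inl fun z hz => ?_
      simpa using hz.apply_D_mul_D
    | consD hy =>
      refine .inl fun z hz => ?_
      simpa [mul_assoc, act_mul] using (hy.isNeg_act hz.apply_D).apply_D_mul_D
    | @consD_inv m _ hy => exact .inr (.inl ⟨_, _, hy, by omega, rfl⟩)
  | consD hx ih =>
    cases hy with
    | single => exact .inr (.inr ⟨_, _, hx, by omega, rfl⟩)
    | consD hy => exact step D (ih hy)
    | consD_inv hy =>
      refine .inl fun z hz => ?_
      have := (hx.isNeg_act_inv (hy.isNeg_act hz.apply_D).apply_D_inv_mul_D_inv).apply_D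
      simpa [mul_assoc, act_mul] using this
  | consD_inv hx ih =>
    cases hy with
    | single =>
      refine .inl fun z hz => ?_
      simpa [mul_assoc, act_mul] using (hx.isNeg_act_inv hz.apply_D_mul_D).apply_D
    | consD hy =>
      refine .inl fun z hz => ?_
      have := (hx.isNeg_act_inv (hy.isNeg_act hz.apply_D).apply_D_mul_D).apply_D
      simpa [mul_assoc, act_mul] using this
    | consD_inv hy => exact step D⁻¹ (ih hy)

theorem Rotation.eq_or_isPos {c d : SL2Z} (hc : Rotation c) (hd : Rotation d) :
    c = d ∨ ∀ z, IsNeg z → IsPos (act (c⁻¹ * d) z) := by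
  cases hc <;> cases hd <;>
    first
    | exact .inl rfl
    | refine .inr fun z hz => ?_
      first
      | simpa using hz.apply_D
      | simpa using hz.apply_D_inv
      | simpa using hz.apply_D_mul_D
      | simpa using hz.apply_D_inv_mul_D_inv

theorem Rotation.twist_mul_eq_or_isPos_mul_left {c d : SL2Z} (hc : Rotation c) (hd : Rotation d) :
    (∀ y, twist (d * y) = twist (c * (D⁻¹ * y))) ∨
      ∀ z, IsNeg z → IsPos (act (D * (c⁻¹ * d)) z) := by
  cases hc <;> cases hd <;>
    first
    | (refine .inl fun y => ?_; simp [twist_D_inv_mul_D_inv_mul]; done)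
    | refine .inr fun z hz => ?_
      first
      | simpa using hz.apply_D
      | simpa using hz.apply_D_inv
      | simpa using hz.apply_D_mul_D

theorem Rotation.twist_mul_eq_or_isPos_mul_right {c d : SL2Z} (hc : Rotation c) (hd : Rotation d) :
    (∀ y, twist (c * y) = twist (d * (D * y))) ∨
      ∀ z, IsNeg z → IsPos (act (c⁻¹ * (d * D)) z) := by
  cases hc <;> cases hd <;>
    first
    | (refine .inl fun y => ?_; simp [twist_D_mul_D_mul]; done)
    | refine .inr fun z hz => ?_
      first
      | simpa using hz.apply_D
      | simpa using hz.apply_D_inv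
      | simpa using hz.apply_D_mul_D

theorem Rotation.twist_mul_twist_or_good {c d : SL2Z} (hc : Rotation c) (hd : Rotation d) :
    twist c * twist d = D ∨ Good c d := by
  cases hc <;> cases hd <;>
    first
    | (refine .inl ?_; decide)
    | refine .inr fun z hz => ?_
      first
      | simpa using hz.apply_D
      | simpa using hz.apply_D_inv
      | simpa using hz.apply_D_mul_D
      | simpa [← mul_assoc, D_mul_D_mul_D] using IsPos.act_neg hz.apply_D

theorem ReducedWord.good_or_eq_or_extends {k l : ℕ} {g h : SL2Z} (hg : ReducedWord k g)
    (hh : ReducedWord l h) :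
    Good g h ∨ twist g * twist h = D ∨ ExtendsRight k g l h ∨ ExtendsLeft k g l h := by
  cases hg with
  | short hc =>
    cases hh with
    | short hd => exact (hc.twist_mul_twist_or_good hd).symm.imp_right .inl
    | long hd hy =>
      rcases hc.twist_mul_eq_or_isPos_mul_left hd with h | h
      · exact .inr (.inr (.inl ⟨_, _, hy, by omega, h _⟩))
      · refine .inl fun z hz => ?_
        simpa [mul_assoc, act_mul] using h _ (hy.isNeg_act hz.apply_D)
  | long hc hx =>
    cases hh with
    | short hd =>
      rcases hc.twist_mul_eq_or_isPos_mul_right hd with h | h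
      · exact .inr (.inr (.inr ⟨_, _, hx, by omega, h _⟩))
      · refine .inl fun z hz => ?_
        simpa [mul_assoc, act_mul] using (hx.isNeg_act_inv (h _ hz)).apply_D
    | long hd hy =>
      rcases hc.eq_or_isPos hd with rfl | h
      · exact (hx.good_or_extends hy).imp good_mul_left_iff.2
          fun h => .inr (h.imp (·.mul_left _ 0) (·.mul_left _ 0))
      · refine .inl fun z hz => ?_
        simpa [mul_assoc, act_mul] using
          (hx.isNeg_act_inv (h _ (hy.isNeg_act hz.apply_D))).apply_D

theorem ReducedWord.exists_costLE_of_extendsRight {k l : ℕ} {g h : SL2Z} (hg : ReducedWord k g)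
    (H : ExtendsRight k g l h) : ∃ m < l, CostLE m (twist g * twist h * (twist g)⁻¹) := by
  obtain ⟨m, x, hx, rfl, e⟩ := H
  cases m with
  | zero => cases hx
  | succ m =>
    refine ⟨k + m, by omega, ?_⟩
    have h1 : twist g * (g * (D⁻¹ * x)) = g * (D * (S * x)) := by
      simp only [twist]; group
    have h2 : CostLE m (twist (D * (S * x))) := by
      rw [twist_mul]; exact hx.costLE_S_mul.conj_D
    rw [e, ← twist_mul, h1]
    exact hg.costLE_mul h2

theorem ReducedWord.exists_costLE_of_extendsLeft {k l : ℕ} {g h : SL2Z} (hh : ReducedWord l h)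
    (H : ExtendsLeft k g l h) : ∃ m < k, CostLE m ((twist h)⁻¹ * twist g * twist h) := by
  obtain ⟨m, x, hx, rfl, e⟩ := H
  cases m with
  | zero => cases hx
  | succ m =>
    refine ⟨l + m, by omega, ?_⟩
    have h1 : (twist h)⁻¹ * (h * (D * x)) = h * (D⁻¹ * (S⁻¹ * x)) := by
      simp only [twist]; group
    have h2 : CostLE m (twist (D⁻¹ * (S⁻¹ * x))) := by
      rw [twist_mul, inv_inv, twist_S_inv_mul]; exact hx.costLE_S_mul.conj_D_inv
    have h3 := twist_mul (twist h)⁻¹ (h * (D * x))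
    rw [h1, inv_inv, ← e] at h3
    rw [← h3]
    exact hh.costLE_mul h2

section Hurwitz

variable {G : Type*} [Group G]

theorem HurwitzMove.append_append {L L' : List G} (h : HurwitzMove L L') (p t : List G) :
    HurwitzMove (p ++ L ++ t) (p ++ L' ++ t) := by
  obtain ⟨q, a, b, s, rfl, h⟩ := h
  refine ⟨p ++ q, a, b, s ++ t, by simp, ?_⟩
  rcases h with rfl | rfl <;> simp

theorem HurwitzMove.length_eq {L L' : List G} (h : HurwitzMove L L') :
    L'.length = L.length := by
  obtain ⟨q, a, b, s, rfl, rfl | rfl⟩ := h <;> simp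

theorem HurwitzMove.prod_eq {L L' : List G} (h : HurwitzMove L L') : L'.prod = L.prod := by
  obtain ⟨q, a, b, s, rfl, rfl | rfl⟩ := h <;> simp [mul_assoc]

theorem HurwitzEquiv.refl (L : List G) : HurwitzEquiv L L := Relation.ReflTransGen.refl

theorem HurwitzEquiv.trans {L₁ L₂ L₃ : List G} (h : HurwitzEquiv L₁ L₂)
    (h' : HurwitzEquiv L₂ L₃) : HurwitzEquiv L₁ L₃ :=
  Relation.ReflTransGen.trans h h'

theorem HurwitzEquiv.append_append {L L' : List G} (h : HurwitzEquiv L L') (p t : List G) :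
    HurwitzEquiv (p ++ L ++ t) (p ++ L' ++ t) := by
  induction h with
  | refl => exact .refl
  | tail _ h ih => exact ih.tail (HurwitzMove.append_append h p t)

theorem HurwitzEquiv.cons {L L' : List G} (h : HurwitzEquiv L L') (a : G) :
    HurwitzEquiv (a :: L) (a :: L') := by
  simpa using HurwitzEquiv.append_append h [a] []

theorem HurwitzEquiv.length_eq {L L' : List G} (h : HurwitzEquiv L L') :
    L'.length = L.length := by
  induction h with
  | refl => rfl
  | tail _ h ih => rw [HurwitzMove.length_eq h, ih]

theorem HurwitzEquiv.prod_eq {L L' : List G} (h : HurwitzEquiv L L') : L'.prod = L.prod := by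
  induction h with
  | refl => rfl
  | tail _ h ih => rw [HurwitzMove.prod_eq h, ih]

theorem HurwitzEquiv.append_cons_conj (p : List G) (a : G) (t : List G) :
    HurwitzEquiv (p ++ a :: t) (a :: (p.map (fun b => a⁻¹ * b * a) ++ t)) := by
  induction p with
  | nil => exact .refl
  | cons b p ih =>
    exact (HurwitzEquiv.cons ih b).tail ⟨[], b, a, _, rfl, .inl (by simp)⟩

theorem HurwitzEquiv.append_cons (p : List G) (a : G) (t : List G) :
    HurwitzEquiv (p ++ a :: t) ((p.prod * a * p.prod⁻¹) :: (p ++ t)) := by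
  induction p with
  | nil => simpa using HurwitzEquiv.refl _
  | cons b p ih =>
    exact (HurwitzEquiv.cons ih b).tail ⟨[], b, _, _, rfl, .inr (by simp [mul_assoc])⟩

theorem HurwitzEquiv.append_replicate {p : List G} {a : G} (h : Commute p.prod a) (n : ℕ) :
    HurwitzEquiv (p ++ List.replicate n a) (List.replicate n a ++ p) := by
  induction n with
  | zero => simpa using HurwitzEquiv.refl _
  | succ n ih =>
    have := HurwitzEquiv.append_cons p a (List.replicate n a)
    rw [h.eq, mul_inv_cancel_right] at this
    simpa [List.replicate_succ] using HurwitzEquiv.trans this (HurwitzEquiv.cons ih a)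

end Hurwitz

/-- A list of reduced words, together with their numbers of letters `S`. -/
def IsReducedList (ws : List (ℕ × SL2Z)) : Prop := ∀ w ∈ ws, ReducedWord w.1 w.2

/-- The sequence of twists along a list of words. -/
def twists (ws : List (ℕ × SL2Z)) : List SL2Z := ws.map fun w => twist w.2

/-- The total number of letters `S` plus the number of words. -/
def weight (ws : List (ℕ × SL2Z)) : ℕ := (ws.map fun w => w.1 + 1).sum

theorem exists_isReducedList (L : List SL2Z) (h : ∀ A ∈ L, IsConj U A) :
    ∃ ws, IsReducedList ws ∧ twists ws = L := by
  induction L with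
  | nil => exact ⟨[], by simp [IsReducedList], rfl⟩
  | cons A L ih =>
    obtain ⟨ws, h1, rfl⟩ := ih fun B hB => h B (by simp [hB])
    obtain ⟨k, l, hl, g, hg, rfl⟩ := exists_costLE_of_isConj (h A (by simp))
    exact ⟨(l, g) :: ws, by simpa [IsReducedList, hg] using h1, rfl⟩

theorem IsReducedList.exists_conj_D_inv {ws : List (ℕ × SL2Z)} (h : IsReducedList ws) :
    ∃ ws', IsReducedList ws' ∧ weight ws' ≤ weight ws ∧
      twists ws' = (twists ws).map fun A => D⁻¹ * A * D := by
  induction ws with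
  | nil => exact ⟨[], h, le_rfl, rfl⟩
  | cons w ws ih =>
    simp only [IsReducedList, List.mem_cons, forall_eq_or_imp] at h
    obtain ⟨ws', h1, h2, h3⟩ := ih h.2
    obtain ⟨l, hl, g, hg, e⟩ := h.1.costLE.conj_D_inv
    refine ⟨(l, g) :: ws', by simpa [IsReducedList, hg] using h1, ?_, ?_⟩
    · simp only [weight, List.map_cons, List.sum_cons] at h2 ⊢
      omega
    · simpa [twists, e] using h3

/-- The sequence `L` is Hurwitz equivalent to pairs of factors with product a power of `D`
followed by twists along a good chain of reduced words. -/
def HasNormalForm (L : List SL2Z) : Prop :=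
  ∃ (j : ℕ) (E gs : List SL2Z), HurwitzEquiv L (E ++ gs.map twist) ∧
    E.length = 2 * j ∧ E.prod = D ^ j ∧ gs.IsChain Good ∧ ∀ g ∈ gs, ∃ k, ReducedWord k g

theorem IsReducedList.hasNormalForm {ws : List (ℕ × SL2Z)} (h : IsReducedList ws) :
    HasNormalForm (twists ws) := by
  induction hN : weight ws using Nat.strong_induction_on generalizing ws with
  | _ N ih =>
  subst hN
  by_cases hc : (ws.map Prod.snd).IsChain Good
  · refine ⟨0, [], ws.map Prod.snd, ?_, rfl, by simp, hc, ?_⟩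
    · simpa [twists, Function.comp_def] using HurwitzEquiv.refl _
    · simp only [List.mem_map, forall_exists_index, and_imp]
      rintro _ w hw rfl
      exact ⟨_, h w hw⟩
  rw [List.isChain_map, List.isChain_iff_forall_rel_of_append_cons_cons] at hc
  push Not at hc
  obtain ⟨w₁, w₂, p, t, rfl, hgood⟩ := hc
  simp only [IsReducedList, List.mem_append, List.mem_cons, or_imp, forall_and, forall_eq] at h
  obtain ⟨hp, h₁, h₂, ht⟩ := h
  have hw : weight (p ++ w₁ :: w₂ :: t) = weight p + (w₁.1 + 1 + (w₂.1 + 1 + weight t)) := by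
    simp [weight]
  have replace_pair (v₁ v₂ : ℕ × SL2Z) (hv₁ : ReducedWord v₁.1 v₁.2)
      (hv₂ : ReducedWord v₂.1 v₂.2) (hlt : v₁.1 + v₂.1 < w₁.1 + w₂.1)
      (hm : HurwitzMove (twists (p ++ w₁ :: w₂ :: t)) (twists (p ++ v₁ :: v₂ :: t))) :
      HasNormalForm (twists (p ++ w₁ :: w₂ :: t)) := by
    have hv : weight (p ++ v₁ :: v₂ :: t) = weight p + (v₁.1 + 1 + (v₂.1 + 1 + weight t)) := by
      simp [weight]
    obtain ⟨j, E, gs, hE, rest⟩ := ih _ (by omega)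
      (by
        simp only [IsReducedList, List.mem_append, List.mem_cons, or_imp, forall_and, forall_eq]
        exact ⟨hp, hv₁, hv₂, ht⟩ : IsReducedList (p ++ v₁ :: v₂ :: t)) rfl
    exact ⟨j, E, gs, .head hm hE, rest⟩
  rcases h₁.good_or_eq_or_extends h₂ with H | H | H | H
  · exact absurd H hgood
  · obtain ⟨p', hp', hwp, e⟩ := IsReducedList.exists_conj_D_inv hp
    have hv : weight (p' ++ t) = weight p' + weight t := by simp [weight]
    obtain ⟨j, E, gs, hE, hl, hprod, rest⟩ := ih _ (by omega)
      (by
        simp only [IsReducedList, List.mem_append, or_imp, forall_and]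
        exact ⟨hp', ht⟩ : IsReducedList (p' ++ t)) rfl
    refine ⟨j + 1, twist w₁.2 :: twist w₂.2 :: E, gs, ?_, by simp; omega, ?_, rest⟩
    · have s₁ := HurwitzEquiv.append_cons_conj (twists p) (twist w₁.2) (twist w₂.2 :: twists t)
      have s₂ := HurwitzEquiv.cons (HurwitzEquiv.append_cons_conj
        ((twists p).map fun b => (twist w₁.2)⁻¹ * b * twist w₁.2) (twist w₂.2) (twists t))
        (twist w₁.2)
      have s₃ := HurwitzEquiv.cons (HurwitzEquiv.cons hE (twist w₂.2)) (twist w₁.2)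
      have e' : ((twists p).map fun b => (twist w₁.2)⁻¹ * b * twist w₁.2).map
          (fun b => (twist w₂.2)⁻¹ * b * twist w₂.2) = twists p' := by
        rw [e, ← H, List.map_map]
        simp [Function.comp_def, mul_assoc]
      rw [e'] at s₂
      have := HurwitzEquiv.trans (HurwitzEquiv.trans s₁ s₂) (by simpa [twists] using s₃)
      simpa [twists] using this
    · rw [List.prod_cons, List.prod_cons, hprod, ← mul_assoc, H, pow_succ']
  · obtain ⟨m, hm, l, hl, g, hg, e⟩ := h₁.exists_costLE_of_extendsRight H
    refine replace_pair (l, g) w₁ hg h₁ (by simp; omega)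
      ⟨twists p, twist w₁.2, twist w₂.2, twists t, by simp [twists], .inr ?_⟩
    simp [twists, e]
  · obtain ⟨m, hm, l, hl, g, hg, e⟩ := h₂.exists_costLE_of_extendsLeft H
    refine replace_pair w₂ (l, g) h₂ hg (by simp; omega)
      ⟨twists p, twist w₁.2, twist w₂.2, twists t, by simp [twists], .inl ?_⟩
    simp [twists, e]

theorem isNeg_act_prod_of_isChain {g : SL2Z} {t : List SL2Z} (h : (g :: t).IsChain Good)
    {y : ℤ × ℤ} (hy : IsPos (act (D * ((g :: t).getLast (by simp))⁻¹) y)) :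
    IsNeg (act (D⁻¹ * (g⁻¹ * ((g :: t).map twist).prod)) y) := by
  induction t generalizing g with
  | nil => simpa [twist, mul_assoc, act_mul] using hy.apply_S
  | cons g' t ih =>
    rw [List.isChain_cons_cons] at h
    have := (h.1 _ (ih h.2 (by simpa using hy))).apply_S
    rw [← act_mul, ← act_mul] at this
    rw [List.map_cons, List.prod_cons]
    convert this using 2
    simp only [twist]
    group

theorem ReducedWord.exists_zpow_isNeg {k : ℕ} {g : SL2Z} (h : ReducedWord k g) :
    ∃ i : ℤ, ∀ z, IsNeg z → IsNeg (act (D ^ i * (g * D)) z) := by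
  have rot {c} (hc : Rotation c) : ∃ i : ℤ, D ^ i = c := by
    cases hc with
    | one => exact ⟨0, by simp⟩
    | turn => exact ⟨1, by simp⟩
    | turn_inv => exact ⟨-1, by simp⟩
  cases h with
  | short hc =>
    obtain ⟨i, rfl⟩ := rot hc
    refine ⟨-i - 1, fun z hz => ?_⟩
    rw [← zpow_add_one, ← zpow_add]
    simpa [act_one] using hz
  | long hc hx =>
    obtain ⟨i, rfl⟩ := rot hc
    refine ⟨-i, fun z hz => ?_⟩
    simpa [mul_assoc, act_mul] using hx.isNeg_act hz.apply_D

theorem exists_rotation_zpow (i : ℤ) : ∃ c, Rotation c ∧ (D ^ i = c ∨ D ^ i = -c) := by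
  induction i using Int.induction_on with
  | zero => exact ⟨1, .one, by simp⟩
  | succ i ih =>
    obtain ⟨c, hc, h⟩ := ih
    rw [zpow_add_one]
    rcases hc with _ | _ | _
    · exact ⟨D, .turn, h.imp (by rintro h; simp [h]) (by rintro h; simp [h])⟩
    · exact ⟨D⁻¹, .turn_inv, h.symm.imp (by rintro h; simp [h, D_mul_D])
        (by rintro h; simp [h, D_mul_D])⟩
    · exact ⟨1, .one, h.imp (by rintro h; simp [h]) (by rintro h; simp [h])⟩
  | pred i ih =>
    obtain ⟨c, hc, h⟩ := ih
    rw [zpow_sub_one]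
    rcases hc with _ | _ | _
    · exact ⟨D⁻¹, .turn_inv, h.imp (by rintro h; simp [h]) (by rintro h; simp [h])⟩
    · exact ⟨1, .one, h.imp (by rintro h; simp [h]) (by rintro h; simp [h])⟩
    · exact ⟨D, .turn, h.symm.imp (by rintro h; simp [h, D_inv_mul_D_inv])
        (by rintro h; simp [h, D_inv_mul_D_inv])⟩

theorem exists_rotation_isNeg {p : List SL2Z} {g : SL2Z} (h : (p ++ [g]).IsChain Good)
    (hr : ∀ g' ∈ p ++ [g], ∃ k, ReducedWord k g') {m : ℤ} {n : ℕ}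
    (hprod : ((p ++ [g]).map twist).prod = D ^ m * U ^ n) :
    ∃ c, Rotation c ∧ ∀ y, IsPos (act (D * g⁻¹) y) → IsNeg (act c (act (U ^ n) y)) := by
  obtain ⟨g₁, t, ht⟩ : ∃ g₁ t, p ++ [g] = g₁ :: t := List.exists_cons_of_ne_nil (by simp)
  have hlast : (g₁ :: t).getLast (by simp) = g := by simp [← ht]
  obtain ⟨k, hk⟩ := hr g₁ (by simp [ht])
  obtain ⟨i, hi⟩ := hk.exists_zpow_isNeg
  obtain ⟨c, hc, e⟩ := exists_rotation_zpow (i + m)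
  refine ⟨c, hc, fun y hy => ?_⟩
  rw [ht] at h hprod
  have := hi _ (isNeg_act_prod_of_isChain h (by rwa [hlast]))
  rw [hprod, ← act_mul] at this
  have e' : D ^ i * (g₁ * D) * (D⁻¹ * (g₁⁻¹ * (D ^ m * U ^ n))) = D ^ (i + m) * U ^ n := by
    group
  rw [e', act_mul] at this
  rcases e with e | e
  · rwa [e] at this
  · rw [e] at this
    simpa using IsNeg.act_neg this

theorem InnerWord.exists_isPos_act_inv {k : ℕ} {x : SL2Z} (hx : InnerWord k x) :
    ∃ K₀ : ℤ, ∀ K ≥ K₀, IsPos (act (D * x⁻¹) (-K, 1)) := by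
  induction hx with
  | single =>
    refine ⟨2, fun K hK => ?_⟩
    simp only [act_mul, act_S_inv, act_D, IsPos]
    nlinarith
  | consD _ ih =>
    obtain ⟨K₀, h⟩ := ih
    refine ⟨K₀ + 1, fun K hK => ?_⟩
    have := h (K - 1) (by omega)
    simpa [act_mul, act_S_inv, act_D_inv] using this
  | consD_inv hx _ =>
    refine ⟨2, fun K hK => ?_⟩
    have h : IsPos (K, K - 1) := by simp only [IsPos]; nlinarith
    simpa [act_mul, act_S_inv, act_D] using (hx.isNeg_act_inv h).apply_D

theorem ReducedWord.eq_D_of_rotation_isNeg {k n : ℕ} {g c : SL2Z} (hg : ReducedWord k g)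
    (hc : Rotation c)
    (h : ∀ y, IsPos (act (D * g⁻¹) y) → IsNeg (act c (act (U ^ n) y))) : g = D ∧ n ≠ 0 := by
  have contra {a b : ℤ × ℤ} (ha : IsPos (act (D * g⁻¹) a)) (hb : IsPos (act (D * g⁻¹) b))
      (hab : IsNeg (act c (act (U ^ n) a)) → IsNeg (act c (act (U ^ n) b)) → False) : False :=
    hab (h a ha) (h b hb)
  have neg_case (hneg : ∀ y, IsNeg y → IsPos (act (D * g⁻¹) y)) (hn : n ≠ 0) : False := by
    have hn' : (1 : ℤ) ≤ n := by omega
    refine contra (hneg (-(n + 1), 1) ?_) (hneg (-(2 * n - 1), 2) ?_) ?_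
    · simp only [IsNeg]; linarith
    · simp only [IsNeg]; linarith
    · cases hc <;> simp only [act_one, act_D, act_D_inv, act_U_pow, IsNeg] <;> (ring_nf; omega)
  have zero_case {a b : ℤ × ℤ} (hn : n = 0) (ha : IsPos (act (D * g⁻¹) a))
      (hb : IsPos (act (D * g⁻¹) b)) (hab : IsNeg (act c a) → IsNeg (act c b) → False) :
      False := by
    subst hn
    exact contra ha hb (by simpa [act_one] using hab)
  rcases Nat.eq_zero_or_pos n with hn | hn
  · exfalso
    have h12 : IsPos (1, 2) := by simp [IsPos]
    have h21 : IsPos (2, 1) := by simp [IsPos]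
    have hneg : IsNeg (-1, 1) := by simp [IsNeg]
    have pos_pos (h₁ : IsPos (act (D * g⁻¹) (1, 2))) (h₂ : IsPos (act (D * g⁻¹) (2, 1))) :
        False := by
      refine zero_case hn h₁ h₂ ?_
      cases hc <;> simp [act_one, act_D, act_D_inv, IsNeg]
    have neg_pos (h₁ : IsPos (act (D * g⁻¹) (-1, 1)))
        (h₂ : IsPos (act (D * g⁻¹) (1, 2)) ∨ IsPos (act (D * g⁻¹) (2, 1))) : False := by
      rcases h₂ with h₂ | h₂ <;> refine zero_case hn h₁ h₂ ?_ <;>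
        cases hc <;> simp [act_one, act_D, act_D_inv, IsNeg]
    cases hg with
    | short hd =>
      cases hd with
      | one => exact neg_pos (by simp [act_D, IsPos]) (by simp [act_D, IsPos])
      | turn => exact pos_pos (by simp [act_one, IsPos]) (by simp [act_one, IsPos])
      | turn_inv =>
        exact neg_pos (by simp [act_mul, act_D, IsPos]) (.inr (by simp [act_mul, act_D, IsPos]))
    | long hd hx =>
      cases hd with
      | one =>
        exact pos_pos (by simpa [act_mul] using (hx.isNeg_act_inv h12).apply_D)
          (by simpa [act_mul] using (hx.isNeg_act_inv h21).apply_D)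
      | turn =>
        refine neg_pos
          (by simpa [act_mul] using (hx.isNeg_act_inv hneg.apply_D_inv).apply_D) (.inr ?_)
        simpa [act_mul, act_D_inv] using (hx.isNeg_act_inv h12).apply_D
      | turn_inv =>
        refine neg_pos
          (by simpa [act_mul] using (hx.isNeg_act_inv hneg.apply_D).apply_D) (.inl ?_)
        simpa [act_mul, act_D] using (hx.isNeg_act_inv h21).apply_D
  refine ⟨?_, hn.ne'⟩
  by_contra hgD
  cases hg with
  | short hd =>
    cases hd with
    | one => exact neg_case (fun y hy => by simpa using hy.apply_D) hn.ne'
    | turn => exact hgD rfl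
    | turn_inv => exact neg_case (fun y hy => by simpa using hy.apply_D_mul_D) hn.ne'
  | long hd hx =>
    cases hd with
    | one =>
      rw [one_mul] at contra
      obtain ⟨K₀, hK⟩ := hx.exists_isPos_act_inv
      refine contra (hK (max K₀ (n + 1)) (le_max_left _ _)) (b := (1, 2)) ?_ ?_
      · simpa [act_mul] using (hx.isNeg_act_inv (y := (1, 2)) (by simp [IsPos])).apply_D
      · have := le_max_right K₀ (n + 1)
        cases hc <;> simp only [act_one, act_D, act_D_inv, act_U_pow, IsNeg] <;> intro h₁ h₂ <;>
          nlinarith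
    | turn =>
      refine neg_case (fun y hy => ?_) hn.ne'
      simpa [act_mul] using (hx.isNeg_act_inv hy.apply_D_inv).apply_D
    | turn_inv =>
      refine neg_case (fun y hy => ?_) hn.ne'
      simpa [act_mul] using (hx.isNeg_act_inv hy.apply_D).apply_D

theorem map_twist_eq_replicate (m : ℤ) (n : ℕ) (gs : List SL2Z) (h : gs.IsChain Good)
    (hr : ∀ g ∈ gs, ∃ k, ReducedWord k g) (hprod : (gs.map twist).prod = D ^ m * U ^ n) :
    gs.map twist = List.replicate n U := by
  rcases gs.eq_nil_or_concat' with rfl | ⟨p, g, rfl⟩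
  · cases n with
    | zero => rfl
    | succ n =>
      exfalso
      obtain ⟨c, hc, e⟩ := exists_rotation_zpow m
      have key (y : ℤ × ℤ) : y = act (D ^ m) (act (U ^ (n + 1)) y) := by
        rw [← act_mul, ← hprod]; simp [act_one]
      have h₁ := key (1, 0)
      have h₂ := key (0, 1)
      rw [act_U_pow] at h₁ h₂
      rcases e with e | e <;> rw [e] at h₁ h₂ <;> cases hc <;>
        (simp [act_neg, act_one, act_D, act_D_inv] at h₁ h₂; try omega)
  · obtain ⟨c, hc, hneg⟩ := exists_rotation_isNeg h hr hprod
    obtain ⟨k, hg⟩ := hr g (by simp)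
    obtain ⟨rfl, hn⟩ := hg.eq_D_of_rotation_isNeg hc hneg
    obtain ⟨n, rfl⟩ := Nat.exists_eq_succ_of_ne_zero hn
    rw [List.map_append, List.prod_append, List.map_singleton, List.prod_singleton, twist_D,
      pow_succ, ← mul_assoc, mul_left_inj] at hprod
    rw [List.map_append, map_twist_eq_replicate m n p h.left_of_append
      (fun g hg => hr g (by simp [hg])) hprod, List.map_singleton, twist_D,
      List.replicate_succ']

theorem three_le_of_D_pow {j : ℕ} (h : D ^ j = -1) : 3 ≤ j := by
  by_contra! hj
  interval_cases j <;> revert h <;> decide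

end HurwitzSL2Z

/-- **Normal factorization for Kodaira type `Iₙ*`** : if `-Uⁿ = G₁⋯Gᵣ` with each `Gᵢ` a
conjugate of `U` in `SL(2,ℤ)`, then `r ≥ n + 6` and a finite sequence of Hurwitz moves
transforms `(G₁,…,Gᵣ)` into `(U,…,U,Dₙ₊₁,…,Dᵣ)` (with `n` copies of `U`) where
`Dₙ₊₁⋯Dᵣ = -1`. -/
theorem normal_factorization_Instar (n : ℕ) (L : List SL2Z)
    (hconj : ∀ A ∈ L, IsConj U A)
    (hprod : L.prod = -(U ^ n)) :
    n + 6 ≤ L.length ∧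
    ∃ D : List SL2Z,
      HurwitzEquiv L (List.replicate n U ++ D) ∧ D.prod = -(1 : SL2Z) := by
  obtain ⟨ws, hws, rfl⟩ := HurwitzSL2Z.exists_isReducedList L hconj
  obtain ⟨j, E, gs, hE, hlen, hEprod, hchain, hred⟩ := hws.hasNormalForm
  have hprod' := HurwitzSL2Z.HurwitzEquiv.prod_eq hE
  rw [hprod, List.prod_append, hEprod] at hprod'
  have hrep : gs.map HurwitzSL2Z.twist = List.replicate n U := by
    refine HurwitzSL2Z.map_twist_eq_replicate (3 - j) n gs hchain hred ?_
    have h3 : HurwitzSL2Z.D ^ (3 : ℤ) = -1 := by decide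
    rw [zpow_sub, h3, zpow_natCast, eq_comm, ← mul_right_inj (HurwitzSL2Z.D ^ j), hprod']
    simp
  rw [hrep] at hE hprod'
  rw [List.prod_replicate, neg_eq_neg_one_mul, mul_left_inj] at hprod'
  have hj := HurwitzSL2Z.three_le_of_D_pow hprod'
  have hL := HurwitzSL2Z.HurwitzEquiv.length_eq hE
  rw [List.length_append, List.length_replicate, hlen] at hL
  refine ⟨by omega, E, HurwitzSL2Z.HurwitzEquiv.trans hE
    (HurwitzSL2Z.HurwitzEquiv.append_replicate ?_ n), hEprod.trans hprod'⟩
  rw [hEprod, hprod']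
  exact (Commute.one_left U).neg_left
end
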